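/- arXiv:2408.04599 — 2 statements merged into one kernel-verified Lean document; each statement's English description precedes it below -/
import Mathlib

section
/- Assume the sprinkling setup and let b > 0 be a constant. There exist constants c > 0, δ > 0 (sufficiently small with respect to λ-1 and d) and C > 0 (sufficiently large with respect to b, d, and λ) such that for every ε > 0 there exists n_0 with the following property: for every n ≥ n_0 and every d-regular graph G on n vertices satisfying (P1) and (P2), with probability at least 1-ε there is a single connected component K of G_2 = G_{p_1} ∪ G_{p_2} with W ⊆ V(K). -/
open scoped Classical

/-- Number of edges of `G` with both endpoints in `U`. -/
noncomputable def edgesWithin {V : Type*} (G : SimpleGraph V) (U : Set V) : ℕ :=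
  {e ∈ G.edgeSet | ∀ v ∈ e, v ∈ U}.ncard

/-- Number of edges of `G` with exactly one endpoint in `U`. -/
noncomputable def edgesAcross {V : Type*} (G : SimpleGraph V) (U : Set V) : ℕ :=
  {e ∈ G.edgeSet | (∃ a ∈ e, a ∈ U) ∧ (∃ b ∈ e, b ∉ U)}.ncard

/-- `G` is `d`-regular. -/
def isRegular {V : Type*} (G : SimpleGraph V) (d : ℕ) : Prop :=
  ∀ v, (G.neighborSet v).ncard = d

/-- The number of vertices of the connected component of `v` in `H`. -/
noncomputable def compCard {V : Type*} (H : SimpleGraph V) (v : V) : ℕ :=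
  {u | H.Reachable v u}.ncard

/-- The weight of the edge subset `S` under `p`-bond percolation on `G`. -/
noncomputable def percWeight {V : Type*} [Fintype V] (G : SimpleGraph V) (p : ℝ)
    (S : Finset (Sym2 V)) : ℝ :=
  p ^ S.card * (1 - p) ^ (G.edgeFinset.card - S.card)

/-- The probability, under `p`-bond percolation on `G` (each edge retained independently
with probability `p`), that the retained edge set satisfies `Q`. -/
noncomputable def percProb {V : Type*} [Fintype V] (G : SimpleGraph V) (p : ℝ)
    (Q : Finset (Sym2 V) → Prop) : ℝ :=
  ∑ S ∈ G.edgeFinset.powerset, if Q S then percWeight G p S else 0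

/-- The probability, under two independent bond percolations on `G` with probabilities
`p₁` and `p₂`, that the pair of retained edge sets satisfies `Q`. -/
noncomputable def percProb2 {V : Type*} [Fintype V] (G : SimpleGraph V) (p₁ p₂ : ℝ)
    (Q : Finset (Sym2 V) → Finset (Sym2 V) → Prop) : ℝ :=
  ∑ S₁ ∈ G.edgeFinset.powerset, ∑ S₂ ∈ G.edgeFinset.powerset,
    if Q S₁ S₂ then percWeight G p₁ S₁ * percWeight G p₂ S₂ else 0

/-- The weight of `S ⊆ E` when each element of `E` is retained independently with
probability `p`. -/
noncomputable def bernWeight {α : Type*} (E : Finset α) (p : ℝ) (S : Finset α) : ℝ :=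
  p ^ S.card * (1 - p) ^ (E.card - S.card)

/-- The probability that the random subset of `E`, each element being retained independently
with probability `p`, satisfies `Q`. -/
noncomputable def bernProb {α : Type*} (E : Finset α) (p : ℝ) (Q : Finset α → Prop) : ℝ :=
  ∑ S ∈ E.powerset, if Q S then bernWeight E p S else 0

section Bernoulli

variable {α : Type*} {E : Finset α} {p : ℝ}

lemma bernWeight_nonneg (hp0 : 0 ≤ p) (hp1 : p ≤ 1) (S : Finset α) : 0 ≤ bernWeight E p S :=
  mul_nonneg (pow_nonneg hp0 _) (pow_nonneg (by linarith) _)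

lemma sum_bernWeight (E : Finset α) (p : ℝ) : ∑ S ∈ E.powerset, bernWeight E p S = 1 := by
  have h := Finset.sum_pow_mul_eq_add_pow p (1 - p) E
  simpa [bernWeight] using h

lemma bernProb_true (E : Finset α) (p : ℝ) : bernProb E p (fun _ => True) = 1 := by
  simp [bernProb, sum_bernWeight]

lemma bernProb_add_not (E : Finset α) (p : ℝ) (Q : Finset α → Prop) :
    bernProb E p Q + bernProb E p (fun S => ¬ Q S) = 1 := by
  rw [← sum_bernWeight E p, bernProb, bernProb, ← Finset.sum_add_distrib]
  refine Finset.sum_congr rfl fun S _ => ?_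
  by_cases h : Q S <;> simp [h]

lemma bernProb_nonneg (hp0 : 0 ≤ p) (hp1 : p ≤ 1) (Q : Finset α → Prop) :
    0 ≤ bernProb E p Q :=
  Finset.sum_nonneg fun S _ => by
    split_ifs
    exacts [bernWeight_nonneg hp0 hp1 S, le_rfl]

lemma bernProb_congr {Q Q' : Finset α → Prop} (h : ∀ S ⊆ E, (Q S ↔ Q' S)) :
    bernProb E p Q = bernProb E p Q' :=
  Finset.sum_congr rfl fun S hS => if_congr (h S (Finset.mem_powerset.1 hS)) rfl rfl

lemma bernProb_mono (hp0 : 0 ≤ p) (hp1 : p ≤ 1) {Q Q' : Finset α → Prop}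
    (h : ∀ S ⊆ E, Q S → Q' S) : bernProb E p Q ≤ bernProb E p Q' := by
  refine Finset.sum_le_sum fun S hS => ?_
  have := bernWeight_nonneg (E := E) hp0 hp1 S
  have := h S (Finset.mem_powerset.1 hS)
  split_ifs <;> first | linarith | tauto

lemma bernProb_le_sum {ι : Type*} (hp0 : 0 ≤ p) (hp1 : p ≤ 1) {Q : Finset α → Prop}
    (I : Finset ι) (R : ι → Finset α → Prop) (h : ∀ S ⊆ E, Q S → ∃ i ∈ I, R i S) :
    bernProb E p Q ≤ ∑ i ∈ I, bernProb E p (R i) := by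
  unfold bernProb
  rw [Finset.sum_comm]
  refine Finset.sum_le_sum fun S hS => ?_
  have hw := bernWeight_nonneg (E := E) hp0 hp1 S
  have hnn : ∀ i ∈ I, 0 ≤ (if R i S then bernWeight E p S else 0) := fun i _ => by
    split_ifs <;> linarith
  split_ifs with hQ
  · obtain ⟨i, hi, hR⟩ := h S (Finset.mem_powerset.1 hS) hQ
    calc bernWeight E p S = if R i S then bernWeight E p S else 0 := by simp [hR]
      _ ≤ _ := Finset.single_le_sum hnn hi
  · exact Finset.sum_nonneg hnn

lemma bernProb_or_le (hp0 : 0 ≤ p) (hp1 : p ≤ 1) {Q Q₁ Q₂ : Finset α → Prop}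
    (h : ∀ S ⊆ E, Q S → Q₁ S ∨ Q₂ S) :
    bernProb E p Q ≤ bernProb E p Q₁ + bernProb E p Q₂ := by
  have := bernProb_le_sum hp0 hp1 (Q := Q) (Finset.univ : Finset Bool)
    (fun i => bif i then Q₁ else Q₂) (E := E) fun S hS hQ => by
      rcases h S hS hQ with h | h
      · exact ⟨true, by simp, h⟩
      · exact ⟨false, by simp, h⟩
  simpa using this

lemma sum_bernProb_eq_le_one {ι : Type*} (hp0 : 0 ≤ p) (hp1 : p ≤ 1) (I : Finset ι)
    (f : Finset α → ι) : ∑ i ∈ I, bernProb E p (fun S => f S = i) ≤ 1 := by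
  rw [← sum_bernWeight E p]
  unfold bernProb
  rw [Finset.sum_comm]
  refine Finset.sum_le_sum fun S _ => ?_
  by_cases hS : f S ∈ I
  · rw [Finset.sum_eq_single_of_mem (f S) hS fun i _ hi => if_neg (Ne.symm hi), if_pos rfl]
  · rw [Finset.sum_eq_zero fun i hi => if_neg fun h : f S = i => hS (h ▸ hi)]
    exact bernWeight_nonneg hp0 hp1 S

/-- The restrictions of the random set to disjoint sets of elements are independent. -/
lemma bernProb_and_inter [DecidableEq α] {T R : Finset α} (hTR : Disjoint T R)
    (f g : Finset α → Prop) :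
    bernProb (T ∪ R) p (fun S => f (S ∩ T) ∧ g (S ∩ R)) = bernProb T p f * bernProb R p g := by
  unfold bernProb
  rw [Finset.sum_mul_sum, ← Finset.sum_product']
  refine Finset.sum_bij' (fun S _ => (S ∩ T, S ∩ R)) (fun x _ => x.1 ∪ x.2) ?_ ?_ ?_ ?_ ?_
  · intro S _
    simp
  · rintro ⟨A, B⟩ h
    simp only [Finset.mem_product, Finset.mem_powerset] at h ⊢
    exact Finset.union_subset_union h.1 h.2
  · intro S hS
    rw [Finset.mem_powerset] at hS
    simp only [← Finset.inter_union_distrib_left]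
    exact Finset.inter_eq_left.2 hS
  · rintro ⟨A, B⟩ h
    simp only [Finset.mem_product, Finset.mem_powerset] at h
    have hBT : B ∩ T = ∅ := Finset.disjoint_iff_inter_eq_empty.1 (hTR.symm.mono_left h.2)
    have hAR : A ∩ R = ∅ := Finset.disjoint_iff_inter_eq_empty.1 (hTR.mono_left h.1)
    simp [Finset.union_inter_distrib_right, hBT, hAR, Finset.inter_eq_left.2 h.1,
      Finset.inter_eq_left.2 h.2]
  · intro S hS
    rw [Finset.mem_powerset] at hS
    have hc : (S ∩ T).card + (S ∩ R).card = S.card := by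
      rw [← Finset.card_union_of_disjoint, ← Finset.inter_union_distrib_left,
        Finset.inter_eq_left.2 hS]
      exact hTR.mono Finset.inter_subset_right Finset.inter_subset_right
    have hT : (S ∩ T).card ≤ T.card := Finset.card_le_card Finset.inter_subset_right
    have hR : (S ∩ R).card ≤ R.card := Finset.card_le_card Finset.inter_subset_right
    have hw : bernWeight (T ∪ R) p S = bernWeight T p (S ∩ T) * bernWeight R p (S ∩ R) := by
      unfold bernWeight
      rw [Finset.card_union_of_disjoint hTR, ← hc,
        show T.card + R.card - ((S ∩ T).card + (S ∩ R).card)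
          = (T.card - (S ∩ T).card) + (R.card - (S ∩ R).card) by omega, pow_add, pow_add]
      ring
    by_cases h1 : f (S ∩ T) <;> by_cases h2 : g (S ∩ R) <;> simp [h1, h2, hw]

lemma bernProb_inter [DecidableEq α] {T : Finset α} (hT : T ⊆ E) (f : Finset α → Prop) :
    bernProb E p (fun S => f (S ∩ T)) = bernProb T p f := by
  have h := bernProb_and_inter (p := p) (Finset.disjoint_sdiff (s := T) (t := E)) f
    (fun _ => True)
  rw [Finset.union_sdiff_of_subset hT, bernProb_true, mul_one] at h
  simpa using h

lemma bernProb_not_subset_self (T : Finset α) (p : ℝ) :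
    bernProb T p (fun S => ¬ T ⊆ S) = 1 - p ^ T.card := by
  have h := bernProb_add_not T p (fun S => T ⊆ S)
  have h' : bernProb T p (fun S => T ⊆ S) = p ^ T.card := by
    unfold bernProb
    rw [Finset.sum_eq_single T]
    · simp [bernWeight]
    · intro S hS hne
      rw [Finset.mem_powerset] at hS
      rw [if_neg]
      exact fun h => hne (hS.antisymm h)
    · simp
  linarith

/-- The probability of containing none of pairwise disjoint sets of bounded size. -/
lemma bernProb_forall_not_subset_le {ι : Type*} (hp0 : 0 ≤ p) (hp1 : p ≤ 1) (l : ℕ)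
    (F : ι → Finset α) (I : Finset ι) :
    ∀ E : Finset α, (∀ i ∈ I, F i ⊆ E) → (∀ i ∈ I, (F i).card ≤ l) →
    (∀ i ∈ I, ∀ j ∈ I, i ≠ j → Disjoint (F i) (F j)) →
    bernProb E p (fun S => ∀ i ∈ I, ¬ F i ⊆ S) ≤ (1 - p ^ l) ^ I.card := by
  induction I using Finset.induction_on with
  | empty =>
    intro E _ _ _
    simp [bernProb_true]
  | insert a I ha ih =>
    intro E hE hl hd
    have hFa := hE a (Finset.mem_insert_self _ _)
    have hsub : ∀ i ∈ I, F i ⊆ E \ F a := fun i hi => by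
      refine Finset.subset_sdiff.2 ⟨hE i (Finset.mem_insert_of_mem hi), ?_⟩
      exact hd i (Finset.mem_insert_of_mem hi) a (Finset.mem_insert_self _ _)
        (fun h => ha (h ▸ hi))
    have h := bernProb_and_inter (p := p) (Finset.disjoint_sdiff (s := F a) (t := E))
      (fun S => ¬ F a ⊆ S) (fun S => ∀ i ∈ I, ¬ F i ⊆ S)
    rw [Finset.union_sdiff_of_subset hFa, bernProb_not_subset_self] at h
    have hi := ih (E \ F a) hsub (fun i hi => hl i (Finset.mem_insert_of_mem hi))
      (fun i hi j hj => hd i (Finset.mem_insert_of_mem hi) j (Finset.mem_insert_of_mem hj))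
    have hpow : p ^ l ≤ p ^ (F a).card :=
      pow_le_pow_of_le_one hp0 hp1 (hl a (Finset.mem_insert_self _ _))
    rw [Finset.card_insert_of_notMem ha, pow_succ']
    refine le_trans (le_trans (bernProb_mono hp0 hp1 ?_) h.le)
      (mul_le_mul (by linarith) hi (bernProb_nonneg hp0 hp1 _) ?_)
    · intro S hS hQ
      refine ⟨fun hs => hQ a (Finset.mem_insert_self _ _) (hs.trans Finset.inter_subset_left),
        fun i hi hs => hQ i (Finset.mem_insert_of_mem hi) (hs.trans Finset.inter_subset_left)⟩
    · have := pow_le_one₀ (n := l) hp0 hp1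
      linarith

end Bernoulli

section Hull

variable {V : Type*} [Fintype V]

/-- The union of the components, in the graph with edge set `S`, of the vertices of `B`. -/
noncomputable def openHull (S : Finset (Sym2 V)) (B : Finset V) : Finset V :=
  Finset.univ.filter fun u =>
    ∃ v ∈ B, (SimpleGraph.fromEdgeSet (S : Set (Sym2 V))).Reachable v u

/-- The edges of `G` with at least one endpoint in `U`. -/
noncomputable def touchingEdges (G : SimpleGraph V) (U : Finset V) : Finset (Sym2 V) :=
  G.edgeFinset.filter fun e => ∃ v ∈ e, v ∈ U

lemma mem_openHull {S : Finset (Sym2 V)} {B : Finset V} {u : V} :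
    u ∈ openHull S B ↔ ∃ v ∈ B, (SimpleGraph.fromEdgeSet (S : Set (Sym2 V))).Reachable v u := by
  simp [openHull]

lemma subset_openHull (S : Finset (Sym2 V)) (B : Finset V) : B ⊆ openHull S B :=
  fun v hv => mem_openHull.2 ⟨v, hv, SimpleGraph.Reachable.refl v⟩

lemma openHull_mono {S S' : Finset (Sym2 V)} (h : S ⊆ S') (B : Finset V) :
    openHull S B ⊆ openHull S' B := fun u hu => by
  obtain ⟨v, hv, hr⟩ := mem_openHull.1 hu
  exact mem_openHull.2 ⟨v, hv, hr.mono (SimpleGraph.fromEdgeSet_mono (by exact_mod_cast h))⟩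

lemma mem_openHull_of_mk_mem {S : Finset (Sym2 V)} {B : Finset V} {x y : V}
    (hx : x ∈ openHull S B) (hxy : s(x, y) ∈ S) : y ∈ openHull S B := by
  by_cases hne : x = y
  · exact hne ▸ hx
  obtain ⟨v, hv, hr⟩ := mem_openHull.1 hx
  refine mem_openHull.2 ⟨v, hv, hr.trans (SimpleGraph.Adj.reachable ?_)⟩
  simp [hxy, hne]

lemma openHull_subset_of_closed {S : Finset (Sym2 V)} {B U : Finset V} (hB : B ⊆ U)
    (h : ∀ x y, x ∈ U → s(x, y) ∈ S → y ∈ U) : openHull S B ⊆ U := fun u hu => by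
  obtain ⟨v, hv, hr⟩ := mem_openHull.1 hu
  rw [SimpleGraph.reachable_iff_reflTransGen] at hr
  induction hr with
  | refl => exact hB hv
  | tail hab hbc ih =>
    refine h _ _ (ih (mem_openHull.2 ⟨v, hv, ?_⟩)) (by simpa using And.left hbc)
    rwa [SimpleGraph.reachable_iff_reflTransGen]

/-- Whether the hull equals `U` is determined by the edges touching `U`. -/
lemma openHull_eq_iff_inter (G : SimpleGraph V) {S : Finset (Sym2 V)} (hS : S ⊆ G.edgeFinset)
    (B U : Finset V) :
    openHull S B = U ↔ openHull (S ∩ touchingEdges G U) B = U := by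
  have key : ∀ x y, x ∈ U → s(x, y) ∈ S → s(x, y) ∈ S ∩ touchingEdges G U := by
    intro x y hx hxy
    exact Finset.mem_inter.2 ⟨hxy, Finset.mem_filter.2 ⟨hS hxy, x, by simp, hx⟩⟩
  constructor
  · rintro h
    refine (h ▸ openHull_mono Finset.inter_subset_left B).antisymm ?_
    intro u hu
    have : openHull S B ⊆ openHull (S ∩ touchingEdges G U) B := by
      refine openHull_subset_of_closed (subset_openHull _ _) fun x y hx hxy => ?_
      refine mem_openHull_of_mk_mem hx (key x y ?_ hxy)
      rw [← h]
      exact openHull_mono Finset.inter_subset_left B hx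
    exact this (h.symm ▸ hu)
  · intro h
    refine (openHull_subset_of_closed ?_ fun x y hx hxy => ?_).antisymm ?_
    · rw [← h]
      exact subset_openHull _ _
    · have hx' : x ∈ openHull (S ∩ touchingEdges G U) B := h.symm ▸ hx
      have := mem_openHull_of_mk_mem hx' (key x y hx hxy)
      rwa [h] at this
    · nth_rewrite 1 [← h]
      exact openHull_mono Finset.inter_subset_left B

lemma edgesWithin_eq_card (G : SimpleGraph V) (U : Finset V) :
    edgesWithin G (U : Set V) = (G.edgeFinset.filter fun e => ∀ v ∈ e, v ∈ U).card := by
  rw [edgesWithin, ← Set.ncard_coe_finset]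
  congr 1
  ext e
  simp

lemma edgesAcross_eq_card (G : SimpleGraph V) (U : Finset V) :
    edgesAcross G (U : Set V) =
      (G.edgeFinset.filter fun e => (∃ a ∈ e, a ∈ U) ∧ ∃ a ∈ e, a ∉ U).card := by
  rw [edgesAcross, ← Set.ncard_coe_finset]
  congr 1
  ext e
  simp

lemma isRegular.card_incident {G : SimpleGraph V} {d : ℕ} (h : isRegular G d) (v : V) :
    (G.edgeFinset.filter fun e => v ∈ e).card = d := by
  rw [← h v, Set.ncard_eq_toFinset_card', ← SimpleGraph.neighborFinset_def,
    SimpleGraph.card_neighborFinset_eq_degree, ← SimpleGraph.card_incidenceFinset_eq_degree]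
  congr 1
  ext e
  simp [SimpleGraph.mem_incidenceFinset, SimpleGraph.incidenceSet]

/-- Degree counting in a regular graph. -/
lemma isRegular.mul_card_le {G : SimpleGraph V} {d : ℕ} (h : isRegular G d) (U : Finset V) :
    d * U.card ≤ 2 * edgesWithin G (U : Set V) + edgesAcross G (U : Set V) := by
  have h1 : d * U.card = ∑ e ∈ G.edgeFinset, (U.filter fun v => v ∈ e).card := by
    have := Finset.sum_card_bipartiteAbove_eq_sum_card_bipartiteBelow
      (s := U) (t := G.edgeFinset) (fun (v : V) (e : Sym2 V) => v ∈ e)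
    simp only [Finset.bipartiteAbove, Finset.bipartiteBelow] at this
    rw [← this, Finset.sum_congr rfl fun v _ => h.card_incident v]
    simp [mul_comm]
  rw [h1, edgesWithin_eq_card, edgesAcross_eq_card, Finset.card_filter, Finset.card_filter,
    Finset.mul_sum, ← Finset.sum_add_distrib]
  refine Finset.sum_le_sum fun e _ => ?_
  induction e with
  | h x y =>
    have hle : (U.filter fun v => v ∈ s(x, y)) ⊆ ({x, y} : Finset V).filter (· ∈ U) := by
      intro v
      simp only [Finset.mem_filter, Sym2.mem_iff, Finset.mem_insert, Finset.mem_singleton]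
      tauto
    refine (Finset.card_le_card hle).trans ?_
    by_cases hx : x ∈ U <;> by_cases hy : y ∈ U <;>
      simp [hx, hy, Finset.filter_insert, Finset.filter_singleton, Finset.card_le_two]

/-- Comparison of the weights of an edge set with few retained and many deleted edges. -/
lemma weight_le_exp_mul_weight {p q θ a z' k : ℝ} {s z : ℕ} (hq0 : 0 < q) (hqp : q ≤ p)
    (hp1 : p < 1) (hs : (s : ℝ) ≤ a * k) (hz : z' * k ≤ z) (hk : 0 ≤ k)
    (hθ : a * Real.log (p / q) + z' * Real.log ((1 - p) / (1 - q)) ≤ -θ) :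
    p ^ s * (1 - p) ^ z ≤ Real.exp (-θ * k) * (q ^ s * (1 - q) ^ z) := by
  have hp0 : 0 < p := hq0.trans_le hqp
  have h1q : 0 < 1 - q := by linarith
  have h1p : 0 < 1 - p := by linarith
  have e1 : p ^ s = q ^ s * Real.exp (s * Real.log (p / q)) := by
    rw [← Real.log_pow, Real.exp_log (by positivity), div_pow]
    field_simp
  have e2 : (1 - p) ^ z = (1 - q) ^ z * Real.exp (z * Real.log ((1 - p) / (1 - q))) := by
    rw [← Real.log_pow, Real.exp_log (by positivity), div_pow]
    field_simp
  have l1 : 0 ≤ Real.log (p / q) := Real.log_nonneg ((one_le_div hq0).2 hqp)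
  have l2 : Real.log ((1 - p) / (1 - q)) ≤ 0 :=
    Real.log_nonpos (by positivity) ((div_le_one h1q).2 (by linarith))
  have : (s : ℝ) * Real.log (p / q) + z * Real.log ((1 - p) / (1 - q)) ≤ -θ * k := by
    nlinarith [mul_le_mul_of_nonneg_right hs l1, mul_le_mul_of_nonpos_right hz l2,
      mul_le_mul_of_nonneg_right hθ hk]
  rw [e1, e2]
  calc _ = Real.exp (s * Real.log (p / q) + z * Real.log ((1 - p) / (1 - q)))
        * (q ^ s * (1 - q) ^ z) := by rw [Real.exp_add]; ring
    _ ≤ _ := mul_le_mul_of_nonneg_right (Real.exp_le_exp.2 this) (by positivity)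

/-- Change of measure for the event that the hull of `B` is a locally sparse set `U`. -/
lemma bernProb_openHull_eq_le {G : SimpleGraph V} {d : ℕ} (hG : isRegular G d)
    {p q θ c : ℝ} (hq0 : 0 < q) (hqp : q ≤ p) (hp1 : p < 1)
    (hθ : (1 + c) * Real.log (p / q) + ((d : ℝ) - 2 - 2 * c) * Real.log ((1 - p) / (1 - q)) ≤ -θ)
    (B U : Finset V) (hU : (edgesWithin G (U : Set V) : ℝ) ≤ (1 + c) * U.card) :
    bernProb G.edgeFinset p (fun S => openHull S B = U) ≤
      Real.exp (-θ * U.card) * bernProb G.edgeFinset q (fun S => openHull S B = U) := by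
  set T := touchingEdges G U with hTdef
  have hT : T ⊆ G.edgeFinset := Finset.filter_subset _ _
  have red : ∀ x : ℝ, bernProb G.edgeFinset x (fun S => openHull S B = U) =
      bernProb T x (fun S => openHull S B = U) := by
    intro x
    rw [← bernProb_inter hT]
    exact bernProb_congr fun S hS => openHull_eq_iff_inter G hS B U
  rw [red, red, bernProb, bernProb, Finset.mul_sum]
  refine Finset.sum_le_sum fun S hS => ?_
  rw [Finset.mem_powerset] at hS
  split_ifs with hH
  swap
  · simp
  have hin : S ⊆ G.edgeFinset.filter fun e => ∀ v ∈ e, v ∈ U := by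
    intro e he
    obtain ⟨heG, x, hx, hxU⟩ := Finset.mem_filter.1 (hS he)
    refine Finset.mem_filter.2 ⟨heG, fun v hv => ?_⟩
    by_cases hvx : v = x
    · exact hvx ▸ hxU
    have hmk : e = s(x, v) := (Sym2.mem_and_mem_iff (Ne.symm hvx)).1 ⟨hx, hv⟩
    rw [← hH] at hxU ⊢
    exact mem_openHull_of_mk_mem hxU (hmk ▸ he)
  have hs : S.card ≤ edgesWithin G (U : Set V) := by
    rw [edgesWithin_eq_card]
    exact Finset.card_le_card hin
  have hz : edgesAcross G (U : Set V) ≤ T.card - S.card := by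
    rw [edgesAcross_eq_card, ← Finset.card_sdiff_of_subset hS]
    refine Finset.card_le_card fun e he => ?_
    obtain ⟨heG, h1, v, hv, hvU⟩ := Finset.mem_filter.1 he
    refine Finset.mem_sdiff.2 ⟨Finset.mem_filter.2 ⟨heG, h1⟩, fun heS => hvU ?_⟩
    exact (Finset.mem_filter.1 (hin heS)).2 v hv
  refine weight_le_exp_mul_weight (a := 1 + c) (z' := (d : ℝ) - 2 - 2 * c) hq0 hqp hp1 ?_ ?_
    (Nat.cast_nonneg _) hθ
  · exact le_trans (by exact_mod_cast hs) hU
  · have h1 : (d : ℝ) * U.card ≤ 2 * edgesWithin G (U : Set V) + edgesAcross G (U : Set V) := by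
      exact_mod_cast hG.mul_card_le U
    have h2 : (edgesAcross G (U : Set V) : ℝ) ≤ ((T.card - S.card : ℕ) : ℝ) := by
      exact_mod_cast hz
    nlinarith

/-- In a locally sparse regular graph, supercritical percolation rarely has hulls of
intermediate size. -/
lemma bernProb_card_openHull_le {G : SimpleGraph V} {d : ℕ} (hG : isRegular G d)
    {p q θ c L k₀ : ℝ} (hq0 : 0 < q) (hqp : q ≤ p) (hp1 : p < 1) (hθ0 : 0 ≤ θ)
    (hθ : (1 + c) * Real.log (p / q) + ((d : ℝ) - 2 - 2 * c) * Real.log ((1 - p) / (1 - q)) ≤ -θ)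
    (hP : ∀ U : Finset V, (U.card : ℝ) ≤ L →
      (edgesWithin G (U : Set V) : ℝ) ≤ (1 + c) * U.card) (B : Finset V) :
    bernProb G.edgeFinset p
      (fun S => k₀ ≤ (openHull S B).card ∧ ((openHull S B).card : ℝ) ≤ L) ≤
      Real.exp (-θ * k₀) := by
  have hp0 : 0 ≤ p := (hq0.trans_le hqp).le
  have hq1 : q ≤ 1 := by linarith
  set I : Finset (Finset V) :=
    Finset.univ.filter fun U => k₀ ≤ (U.card : ℝ) ∧ (U.card : ℝ) ≤ L with hI
  calc _ ≤ ∑ U ∈ I, bernProb G.edgeFinset p (fun S => openHull S B = U) :=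
        bernProb_le_sum hp0 hp1.le I (fun U S => openHull S B = U) fun S _ h =>
          ⟨openHull S B, by simpa [hI] using h, rfl⟩
    _ ≤ ∑ U ∈ I, Real.exp (-θ * k₀) * bernProb G.edgeFinset q (fun S => openHull S B = U) := by
        refine Finset.sum_le_sum fun U hU => ?_
        obtain ⟨h1, h2⟩ := (Finset.mem_filter.1 hU).2
        refine (bernProb_openHull_eq_le hG hq0 hqp hp1 hθ B U (hP U h2)).trans ?_
        refine mul_le_mul_of_nonneg_right (Real.exp_le_exp.2 ?_)
          (bernProb_nonneg hq0.le hq1 _)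
        nlinarith
    _ ≤ Real.exp (-θ * k₀) * 1 := by
        rw [← Finset.mul_sum]
        refine mul_le_mul_of_nonneg_left ?_ (Real.exp_pos _).le
        exact sum_bernProb_eq_le_one hq0.le hq1 I fun S => openHull S B
    _ = _ := mul_one _

end Hull

section Cut

variable {V : Type*} [Fintype V]

/-- The vertices at distance at most `i` from `v`. -/
noncomputable def walkBall (G : SimpleGraph V) (i : ℕ) (v : V) : Finset V :=
  Finset.univ.filter fun u => ∃ w : G.Walk v u, w.length ≤ i

/-- The vertices of `U` with a neighbour outside `U`. -/
noncomputable def innerBoundary (G : SimpleGraph V) (U : Finset V) : Finset V :=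
  U.filter fun u => ∃ w, w ∉ U ∧ G.Adj u w

lemma mem_walkBall {G : SimpleGraph V} {i : ℕ} {u v : V} :
    u ∈ walkBall G i v ↔ ∃ w : G.Walk v u, w.length ≤ i := by
  simp [walkBall]

lemma isRegular.card_walkBall_le {G : SimpleGraph V} {d : ℕ} (hG : isRegular G d) (i : ℕ) :
    ∀ v, (walkBall G i v).card ≤ (d + 1) ^ i := by
  induction i with
  | zero =>
    intro v
    have : walkBall G 0 v ⊆ {v} := by
      intro u hu
      obtain ⟨w, hw⟩ := mem_walkBall.1 hu
      simp [SimpleGraph.Walk.eq_of_length_eq_zero (Nat.le_zero.1 hw)]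
    simpa using Finset.card_le_card this
  | succ i ih =>
    intro v
    have hsub : walkBall G (i + 1) v ⊆
        (insert v (G.neighborFinset v)).biUnion fun u => walkBall G i u := by
      intro u hu
      obtain ⟨w, hw⟩ := mem_walkBall.1 hu
      rw [Finset.mem_biUnion]
      cases w with
      | nil => exact ⟨v, by simp, mem_walkBall.2 ⟨SimpleGraph.Walk.nil, by simp⟩⟩
      | cons hadj w' =>
        refine ⟨_, Finset.mem_insert_of_mem ((G.mem_neighborFinset _ _).2 hadj),
          mem_walkBall.2 ⟨w', ?_⟩⟩
        simpa using hw
    have hN : (G.neighborFinset v).card = d := by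
      rw [← hG v, Set.ncard_eq_toFinset_card', ← SimpleGraph.neighborFinset_def]
    calc _ ≤ _ := Finset.card_le_card hsub
      _ ≤ (insert v (G.neighborFinset v)).card * (d + 1) ^ i :=
        Finset.card_biUnion_le_card_mul _ _ _ fun u _ => ih u
      _ ≤ (d + 1) * (d + 1) ^ i := by
        refine Nat.mul_le_mul_right _ ?_
        exact (Finset.card_insert_le _ _).trans (by rw [hN])
      _ = _ := (pow_succ' _ _).symm

lemma edgesAcross_compl (G : SimpleGraph V) (U : Finset V) :
    edgesAcross G ((Uᶜ : Finset V) : Set V) = edgesAcross G (U : Set V) := by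
  rw [edgesAcross_eq_card, edgesAcross_eq_card]
  congr 1
  ext e
  simp [and_comm]

lemma isRegular.edgesAcross_le {G : SimpleGraph V} {d : ℕ} (hG : isRegular G d) (U : Finset V) :
    edgesAcross G (U : Set V) ≤ d * (innerBoundary G U).card := by
  have hsub : (G.edgeFinset.filter fun e => (∃ a ∈ e, a ∈ U) ∧ ∃ a ∈ e, a ∉ U) ⊆
      (innerBoundary G U).biUnion fun u => G.edgeFinset.filter fun e => u ∈ e := by
    intro e he
    obtain ⟨heG, ⟨a, ha, haU⟩, x, hx, hxU⟩ := Finset.mem_filter.1 he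
    have hne : a ≠ x := fun h => hxU (h ▸ haU)
    have hmk : e = s(a, x) := (Sym2.mem_and_mem_iff hne).1 ⟨ha, hx⟩
    refine Finset.mem_biUnion.2 ⟨a, Finset.mem_filter.2 ⟨haU, x, hxU, ?_⟩,
      Finset.mem_filter.2 ⟨heG, ha⟩⟩
    rw [hmk] at heG
    simpa using heG
  rw [edgesAcross_eq_card, mul_comm]
  exact (Finset.card_le_card hsub).trans
    (Finset.card_biUnion_le_card_mul _ _ _ fun u _ => (hG.card_incident u).le)

/-- Exponential growth of balls in an edge expander. -/
lemma isRegular.le_card_walkBall {G : SimpleGraph V} {d : ℕ} (hG : isRegular G d) (hd : 0 < d)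
    {b : ℝ} (hb : 0 < b)
    (hP : ∀ U : Finset V, (U.card : ℝ) ≤ (Fintype.card V : ℝ) / 2 →
      b * U.card ≤ (edgesAcross G (U : Set V) : ℝ)) (v : V) (i : ℕ) :
    min ((Fintype.card V : ℝ) / 2) ((1 + b / d) ^ i) ≤ (walkBall G i v).card := by
  have hd' : (0 : ℝ) < d := by exact_mod_cast hd
  induction i with
  | zero =>
    refine (min_le_right _ _).trans ?_
    have : 0 < (walkBall G 0 v).card :=
      Finset.card_pos.2 ⟨v, mem_walkBall.2 ⟨SimpleGraph.Walk.nil, by simp⟩⟩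
    rw [pow_zero]
    exact_mod_cast this
  | succ i ih =>
    set U := walkBall G i v with hU
    have hmono : U ⊆ walkBall G (i + 1) v := fun u hu => by
      obtain ⟨w, hw⟩ := mem_walkBall.1 hu
      exact mem_walkBall.2 ⟨w, by omega⟩
    by_cases hbig : (Fintype.card V : ℝ) / 2 < U.card
    · refine (min_le_left _ _).trans (hbig.le.trans ?_)
      exact_mod_cast Finset.card_le_card hmono
    · push Not at hbig
      have h1 := hP U hbig
      have hdis : Disjoint U (innerBoundary G Uᶜ) := by
        refine Finset.disjoint_left.2 fun x hx hx' => ?_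
        exact Finset.mem_compl.1 (Finset.mem_filter.1 hx').1 hx
      have hsub : U ∪ innerBoundary G Uᶜ ⊆ walkBall G (i + 1) v := by
        refine Finset.union_subset hmono fun x hx => ?_
        obtain ⟨_, y, hy, hadj⟩ := Finset.mem_filter.1 hx
        obtain ⟨w, hw⟩ := mem_walkBall.1 (by simpa using hy : y ∈ U)
        exact mem_walkBall.2 ⟨w.concat hadj.symm, by simpa using hw⟩
      have h2 : (U.card : ℝ) + (innerBoundary G Uᶜ).card ≤ (walkBall G (i + 1) v).card := by
        rw [← Nat.cast_add, ← Finset.card_union_of_disjoint hdis]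
        exact_mod_cast Finset.card_le_card hsub
      have h3 : (edgesAcross G (U : Set V) : ℝ) ≤ d * (innerBoundary G Uᶜ).card := by
        rw [← edgesAcross_compl]
        exact_mod_cast hG.edgesAcross_le Uᶜ
      have h4 : b / d * U.card ≤ (innerBoundary G Uᶜ).card := by
        rw [div_mul_eq_mul_div, div_le_iff₀ hd']
        linarith
      have hbd : 0 < b / d := by positivity
      rcases min_le_iff.1 ih with h | h
      · exact (min_le_left _ _).trans (by nlinarith)
      · refine (min_le_right _ _).trans ?_
        rw [pow_succ']
        nlinarith [mul_le_mul_of_nonneg_left h (by linarith : (0 : ℝ) ≤ 1 + b / d)]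

/-- Greedy choice of vertices with pairwise disjoint balls. -/
lemma isRegular.exists_separated {G : SimpleGraph V} {d : ℕ} (hG : isRegular G d) (R : ℕ)
    (D : Finset V) :
    ∃ I ⊆ D, (∀ u ∈ I, ∀ w ∈ I, u ≠ w → Disjoint (walkBall G R u) (walkBall G R w)) ∧
      D.card ≤ I.card * (d + 1) ^ (2 * R) := by
  obtain ⟨I, hI, hmax⟩ := Finset.exists_max_image
    (D.powerset.filter fun I => ∀ u ∈ I, ∀ w ∈ I, u ≠ w →
      Disjoint (walkBall G R u) (walkBall G R w)) Finset.card
    ⟨∅, by simp⟩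
  rw [Finset.mem_filter, Finset.mem_powerset] at hI
  refine ⟨I, hI.1, hI.2, ?_⟩
  have hcov : D ⊆ I.biUnion fun u => walkBall G (2 * R) u := by
    intro x hx
    rw [Finset.mem_biUnion]
    by_cases hxI : x ∈ I
    · exact ⟨x, hxI, mem_walkBall.2 ⟨SimpleGraph.Walk.nil, by simp⟩⟩
    by_contra hno
    have hdis : ∀ u ∈ I, Disjoint (walkBall G R u) (walkBall G R x) := by
      intro u hu
      refine Finset.disjoint_left.2 fun y hy hy' => hno ⟨u, hu, ?_⟩
      obtain ⟨w, hw⟩ := mem_walkBall.1 hy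
      obtain ⟨w', hw'⟩ := mem_walkBall.1 hy'
      refine mem_walkBall.2 ⟨w.append w'.reverse, ?_⟩
      rw [SimpleGraph.Walk.length_append, SimpleGraph.Walk.length_reverse]
      omega
    have := hmax (insert x I) <| by
      rw [Finset.mem_filter, Finset.mem_powerset]
      refine ⟨Finset.insert_subset hx hI.1, fun u hu w hw hne => ?_⟩
      rcases Finset.mem_insert.1 hu with hu₁ | hu₁ <;>
        rcases Finset.mem_insert.1 hw with hw₁ | hw₁
      · exact absurd (hu₁.trans hw₁.symm) hne
      · exact hu₁ ▸ (hdis w hw₁).symm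
      · exact hw₁ ▸ hdis u hu₁
      · exact hI.2 u hu₁ w hw₁ hne
    rw [Finset.card_insert_of_notMem hxI] at this
    omega
  exact (Finset.card_le_card hcov).trans
    (Finset.card_biUnion_le_card_mul _ _ _ fun u _ => hG.card_walkBall_le _ u)

lemma mem_walkBall_of_mem_edges {G : SimpleGraph V} {u v x : V} (w : G.Walk u v)
    {e : Sym2 V} (he : e ∈ w.edges) (hx : x ∈ e) : x ∈ walkBall G w.length u := by
  have hs : x ∈ w.support := by
    induction e with
    | h y z =>
      rcases Sym2.mem_iff.1 hx with rfl | rfl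
      · exact w.fst_mem_support_of_mem_edges he
      · exact w.snd_mem_support_of_mem_edges he
  exact mem_walkBall.2 ⟨w.takeUntil x hs, w.length_takeUntil_le_length hs⟩

/-- A short connection between two sets of vertices through a boundary vertex `u`. -/
lemma exists_connecting_edges {G : SimpleGraph V} {r : ℕ} {A A' : Finset V} {u u' : V}
    (hadj : G.Adj u u') (hA : ∃ a ∈ A, a ∈ walkBall G r u) (hA' : ∃ a ∈ A', a ∈ walkBall G r u') :
    ∃ F : Finset (Sym2 V), F ⊆ G.edgeFinset ∧ F.card ≤ 2 * r + 1 ∧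
      (∀ e ∈ F, ∀ x ∈ e, x ∈ walkBall G (r + 1) u) ∧
      ∀ S : Finset (Sym2 V), F ⊆ S → ∃ a ∈ A, ∃ a' ∈ A',
        (SimpleGraph.fromEdgeSet (S : Set (Sym2 V))).Reachable a a' := by
  obtain ⟨a, haA, ha⟩ := hA
  obtain ⟨a', haA', ha'⟩ := hA'
  obtain ⟨w, hw⟩ := mem_walkBall.1 ha
  obtain ⟨w', hw'⟩ := mem_walkBall.1 ha'
  have hmono : ∀ {i j : ℕ} {x : V}, i ≤ j → x ∈ walkBall G i u → x ∈ walkBall G j u := by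
    intro i j x hij hx
    obtain ⟨q, hq⟩ := mem_walkBall.1 hx
    exact mem_walkBall.2 ⟨q, hq.trans hij⟩
  set q := w.reverse.append (SimpleGraph.Walk.cons hadj w') with hq
  refine ⟨q.edges.toFinset, ?_, ?_, ?_, ?_⟩
  · intro e he
    simpa using q.edges_subset_edgeSet (List.mem_toFinset.1 he)
  · refine (List.toFinset_card_le _).trans ?_
    simp only [hq, SimpleGraph.Walk.length_edges, SimpleGraph.Walk.length_append,
      SimpleGraph.Walk.length_reverse, SimpleGraph.Walk.length_cons]
    omega
  · intro e he x hx
    rw [List.mem_toFinset, hq, SimpleGraph.Walk.edges_append, List.mem_append] at he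
    rcases he with he | he
    · rw [SimpleGraph.Walk.edges_reverse, List.mem_reverse] at he
      exact hmono (by omega) (mem_walkBall_of_mem_edges w he hx)
    · refine hmono ?_ (mem_walkBall_of_mem_edges _ he hx)
      simpa using hw'
  · intro S hS
    refine ⟨a, haA, a', haA', (q.transfer _ fun e he => ?_).reachable⟩
    rw [SimpleGraph.edgeSet_fromEdgeSet]
    exact ⟨by exact_mod_cast hS (List.mem_toFinset.2 he),
      G.not_isDiag_of_mem_edgeSet (q.edges_subset_edgeSet he)⟩

/-- Two large sets of vertices that together are dense in an expander are rarely separated by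
percolation. -/
lemma isRegular.bernProb_separated_le {G : SimpleGraph V} {d : ℕ} (hG : isRegular G d)
    (hd : 0 < d) {b p M : ℝ} (hb : 0 < b) (hp0 : 0 ≤ p) (hp1 : p ≤ 1)
    (hP : ∀ U : Finset V, (U.card : ℝ) ≤ (Fintype.card V : ℝ) / 2 →
      b * U.card ≤ (edgesAcross G (U : Set V) : ℝ)) {r : ℕ} {A A' : Finset V}
    (hdis : Disjoint A A') (hnear : ∀ v, ∃ a ∈ A ∪ A', a ∈ walkBall G r v)
    (hA : M ≤ A.card) (hA' : M ≤ A'.card) :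
    bernProb G.edgeFinset p (fun S => ∀ a ∈ A, ∀ a' ∈ A',
      ¬ (SimpleGraph.fromEdgeSet (S : Set (Sym2 V))).Reachable a a') ≤
      Real.exp (-(p ^ (2 * r + 1) * (b * M / (d * ((d : ℝ) + 1) ^ (2 * (r + 1)))))) := by
  have hd' : (0 : ℝ) < d := by exact_mod_cast hd
  set X : Finset V := Finset.univ.filter fun v => v ∉ A' ∧ ∃ a ∈ A, a ∈ walkBall G r v with hX
  have self_mem : ∀ v, v ∈ walkBall G r v := fun v =>
    mem_walkBall.2 ⟨SimpleGraph.Walk.nil, by simp⟩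
  have hAX : A ⊆ X := fun a ha => by
    simp only [hX, Finset.mem_filter, Finset.mem_univ, true_and]
    exact ⟨Finset.disjoint_left.1 hdis ha, a, ha, self_mem a⟩
  have hAX' : A' ⊆ Xᶜ := fun a ha => by
    simp [hX, ha]
  have hXc : ∀ v, v ∉ X → ∃ a ∈ A', a ∈ walkBall G r v := by
    intro v hv
    by_cases hvA : v ∈ A'
    · exact ⟨v, hvA, self_mem v⟩
    obtain ⟨a, ha, har⟩ := hnear v
    rcases Finset.mem_union.1 ha with h | h
    · exact absurd (by simp only [hX, Finset.mem_filter, Finset.mem_univ, true_and]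
                       exact ⟨hvA, a, h, har⟩) hv
    · exact ⟨a, h, har⟩
  have hcross : b * M ≤ (edgesAcross G (X : Set V) : ℝ) := by
    have hsum : (X.card : ℝ) + (Xᶜ.card : ℝ) = Fintype.card V := by
      exact_mod_cast Finset.card_add_card_compl X
    have c1 : (A.card : ℝ) ≤ X.card := by exact_mod_cast Finset.card_le_card hAX
    have c2 : (A'.card : ℝ) ≤ (Xᶜ.card : ℝ) := by exact_mod_cast Finset.card_le_card hAX'
    rcases le_total (X.card : ℝ) ((Fintype.card V : ℝ) / 2) with h | h
    · exact le_trans (mul_le_mul_of_nonneg_left (by linarith) hb.le) (hP X h)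
    · rw [← edgesAcross_compl]
      exact le_trans (mul_le_mul_of_nonneg_left (by linarith) hb.le) (hP Xᶜ (by linarith))
  obtain ⟨I, hID, hsep, hcard⟩ := hG.exists_separated (r + 1) (innerBoundary G X)
  have hF : ∀ u : V, ∃ F : Finset (Sym2 V), u ∈ I → (F ⊆ G.edgeFinset ∧ F.card ≤ 2 * r + 1 ∧
      (∀ e ∈ F, ∀ x ∈ e, x ∈ walkBall G (r + 1) u) ∧
      ∀ S : Finset (Sym2 V), F ⊆ S → ∃ a ∈ A, ∃ a' ∈ A',
        (SimpleGraph.fromEdgeSet (S : Set (Sym2 V))).Reachable a a') := by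
    intro u
    by_cases hu : u ∈ I
    · obtain ⟨huX, u', hu', hadj⟩ := Finset.mem_filter.1 (hID hu)
      obtain ⟨F, hF⟩ := exists_connecting_edges hadj (Finset.mem_filter.1 huX).2.2 (hXc u' hu')
      exact ⟨F, fun _ => hF⟩
    · exact ⟨∅, fun h => absurd h hu⟩
  choose F hF using hF
  have hprob := bernProb_forall_not_subset_le hp0 hp1 (2 * r + 1) F I G.edgeFinset
    (fun u hu => (hF u hu).1) (fun u hu => (hF u hu).2.1) fun u hu w hw hne => by
      refine Finset.disjoint_left.2 fun e he he' => ?_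
      induction e with
      | h x y =>
        exact Finset.disjoint_left.1 (hsep u hu w hw hne)
          ((hF u hu).2.2.1 _ he x (Sym2.mem_mk_left x y))
          ((hF w hw).2.2.1 _ he' x (Sym2.mem_mk_left x y))
  have hIcard : b * M / (d * ((d : ℝ) + 1) ^ (2 * (r + 1))) ≤ I.card := by
    have h1 : (edgesAcross G (X : Set V) : ℝ) ≤ d * (innerBoundary G X).card := by
      exact_mod_cast hG.edgesAcross_le X
    have h2 : ((innerBoundary G X).card : ℝ) ≤ I.card * ((d : ℝ) + 1) ^ (2 * (r + 1)) := by
      exact_mod_cast hcard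
    rw [div_le_iff₀ (by positivity)]
    nlinarith [mul_le_mul_of_nonneg_left h2 hd'.le]
  calc _ ≤ bernProb G.edgeFinset p (fun S => ∀ u ∈ I, ¬ F u ⊆ S) := by
        refine bernProb_mono hp0 hp1 fun S _ h u hu hsub => ?_
        obtain ⟨a, ha, a', ha', hr⟩ := (hF u hu).2.2.2 S hsub
        exact h a ha a' ha' hr
    _ ≤ (1 - p ^ (2 * r + 1)) ^ I.card := hprob
    _ ≤ Real.exp (-(p ^ (2 * r + 1))) ^ I.card :=
        pow_le_pow_left₀ (by have := pow_le_one₀ (n := 2 * r + 1) hp0 hp1; linarith)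
          (Real.one_sub_le_exp_neg _) _
    _ ≤ _ := by
        rw [← Real.exp_nat_mul]
        refine Real.exp_le_exp.2 ?_
        nlinarith [mul_le_mul_of_nonneg_left hIcard (pow_nonneg hp0 (2 * r + 1))]

end Cut

section Merge

variable {V : Type*} [Fintype V]

lemma compCard_eq_card_fiber (H : SimpleGraph V) (v : V) :
    compCard H v = (Finset.univ.filter fun u =>
      H.connectedComponentMk u = H.connectedComponentMk v).card := by
  rw [compCard, ← Set.ncard_coe_finset]
  congr 1
  ext u
  simp only [Set.mem_ofPred_eq, Finset.coe_filter, Finset.mem_univ, true_and,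
    SimpleGraph.ConnectedComponent.eq]
  exact ⟨fun h => h.symm, fun h => h.symm⟩

lemma compCard_eq_card_openHull (S : Finset (Sym2 V)) (v : V) :
    compCard (SimpleGraph.fromEdgeSet (S : Set (Sym2 V))) v = (openHull S {v}).card := by
  rw [compCard, ← Set.ncard_coe_finset]
  congr 1
  ext u
  simp [mem_openHull]

lemma card_openHull_le_sum (S : Finset (Sym2 V)) (B : Finset V) :
    (openHull S B).card ≤
      ∑ v ∈ B, compCard (SimpleGraph.fromEdgeSet (S : Set (Sym2 V))) v := by
  have hsub : openHull S B ⊆ B.biUnion fun v => openHull S {v} := by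
    intro u hu
    obtain ⟨v, hv, hr⟩ := mem_openHull.1 hu
    exact Finset.mem_biUnion.2 ⟨v, hv, mem_openHull.2 ⟨v, by simp, hr⟩⟩
  simp only [compCard_eq_card_openHull]
  exact (Finset.card_le_card hsub).trans Finset.card_biUnion_le

/-- If the large components of `S₁` are very large and close to every vertex, then sprinkling
merges them. -/
lemma isRegular.bernProb_not_merged_le {G : SimpleGraph V} {d : ℕ} (hG : isRegular G d)
    (hd : 0 < d) {b p k₀ L t : ℝ} (hb : 0 < b) (hp0 : 0 ≤ p) (hp1 : p ≤ 1)
    (hP : ∀ U : Finset V, (U.card : ℝ) ≤ (Fintype.card V : ℝ) / 2 →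
      b * U.card ≤ (edgesAcross G (U : Set V) : ℝ)) {r : ℕ}
    (hL : 0 ≤ L) (ht : t ≤ p ^ (2 * r + 1) * (b * L / (d * ((d : ℝ) + 1) ^ (2 * (r + 1)))))
    (S₁ : Finset (Sym2 V))
    (hgap : ∀ v, k₀ ≤ compCard (SimpleGraph.fromEdgeSet (S₁ : Set (Sym2 V))) v →
      L ≤ compCard (SimpleGraph.fromEdgeSet (S₁ : Set (Sym2 V))) v)
    (hnear : ∀ v, ∃ w ∈ walkBall G r v,
      k₀ ≤ compCard (SimpleGraph.fromEdgeSet (S₁ : Set (Sym2 V))) w) :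
    bernProb G.edgeFinset p (fun S₂ => ¬ ∀ w₁ w₂ : V,
      k₀ ≤ compCard (SimpleGraph.fromEdgeSet (S₁ : Set (Sym2 V))) w₁ →
      k₀ ≤ compCard (SimpleGraph.fromEdgeSet (S₁ : Set (Sym2 V))) w₂ →
      (SimpleGraph.fromEdgeSet (S₁ ∪ S₂ : Set (Sym2 V))).Reachable w₁ w₂) ≤
      (1 + Real.exp (-t)) ^ Fintype.card V - 1 := by
  set H := SimpleGraph.fromEdgeSet (S₁ : Set (Sym2 V)) with hH
  let mk : V → H.ConnectedComponent := H.connectedComponentMk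
  set 𝒞 : Finset H.ConnectedComponent :=
    (Finset.univ.filter fun v => k₀ ≤ compCard H v).image mk with h𝒞
  let part : Finset H.ConnectedComponent → Finset V := fun 𝒜 =>
    Finset.univ.filter fun v => mk v ∈ 𝒜
  have mem_part : ∀ {𝒜 v}, v ∈ part 𝒜 ↔ mk v ∈ 𝒜 := by
    intro 𝒜 v
    simp [part]
  have mk_mem : ∀ v, k₀ ≤ compCard H v → mk v ∈ 𝒞 := fun v hv =>
    Finset.mem_image.2 ⟨v, by simpa using hv, rfl⟩
  have hpart : ∀ 𝒜 ⊆ 𝒞, L * 𝒜.card ≤ (part 𝒜).card := by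
    intro 𝒜 h𝒜
    rw [Finset.card_eq_sum_card_fiberwise (f := mk) (t := 𝒜) fun v hv => mem_part.1 hv,
      Nat.cast_sum, mul_comm, ← nsmul_eq_mul]
    refine Finset.card_nsmul_le_sum _ _ _ fun c hc => ?_
    obtain ⟨v, hv, rfl⟩ := Finset.mem_image.1 (h𝒜 hc)
    have := hgap v (by simpa using hv)
    rw [compCard_eq_card_fiber] at this
    refine this.trans ?_
    have hsub : (Finset.univ.filter fun u => H.connectedComponentMk u = H.connectedComponentMk v) ⊆
        (part 𝒜).filter fun u => mk u = mk v := by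
      intro u hu
      have hu' : mk u = mk v := (Finset.mem_filter.1 hu).2
      exact Finset.mem_filter.2 ⟨mem_part.2 (hu' ▸ hc), hu'⟩
    exact_mod_cast Finset.card_le_card hsub
  set I := 𝒞.powerset.filter fun 𝒜 => 𝒜 ≠ ∅ ∧ 𝒜.card ≤ (𝒞 \ 𝒜).card with hI
  let R : Finset H.ConnectedComponent → Finset (Sym2 V) → Prop := fun 𝒜 S =>
    ∀ a ∈ part 𝒜, ∀ a' ∈ part (𝒞 \ 𝒜),
      ¬ (SimpleGraph.fromEdgeSet (S : Set (Sym2 V))).Reachable a a'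
  have hbad : ∀ S ⊆ G.edgeFinset, (¬ ∀ w₁ w₂ : V, k₀ ≤ compCard H w₁ → k₀ ≤ compCard H w₂ →
      (SimpleGraph.fromEdgeSet (S₁ ∪ S : Set (Sym2 V))).Reachable w₁ w₂) → ∃ 𝒜 ∈ I, R 𝒜 S := by
    intro S _ hS
    push Not at hS
    obtain ⟨w₁, w₂, h₁, h₂, hr⟩ := hS
    set K := SimpleGraph.fromEdgeSet (S₁ ∪ S : Set (Sym2 V)) with hK
    have hHK : H ≤ K := SimpleGraph.fromEdgeSet_mono Set.subset_union_left
    have hSK : SimpleGraph.fromEdgeSet (S : Set (Sym2 V)) ≤ K :=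
      SimpleGraph.fromEdgeSet_mono Set.subset_union_right
    set 𝒜 := 𝒞.filter fun c => ∃ v, mk v = c ∧ K.Reachable w₁ v with h𝒜
    have hsub : 𝒜 ⊆ 𝒞 := Finset.filter_subset _ _
    have reach : ∀ v, mk v ∈ 𝒜 → K.Reachable w₁ v := by
      intro v hv
      obtain ⟨_, u, hu, hru⟩ := Finset.mem_filter.1 hv
      exact hru.trans ((SimpleGraph.ConnectedComponent.exact hu).mono hHK)
    have hw₁ : mk w₁ ∈ 𝒜 :=
      Finset.mem_filter.2 ⟨mk_mem _ h₁, w₁, rfl, SimpleGraph.Reachable.refl _⟩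
    have hw₂ : mk w₂ ∈ 𝒞 \ 𝒜 := Finset.mem_sdiff.2 ⟨mk_mem _ h₂, fun h => hr (reach _ h)⟩
    have hR : R 𝒜 S := by
      intro a ha a' ha' hreach
      obtain ⟨h1, h2⟩ := Finset.mem_sdiff.1 (mem_part.1 ha')
      exact h2 (Finset.mem_filter.2 ⟨h1, a', rfl,
        (reach a (mem_part.1 ha)).trans (hreach.mono hSK)⟩)
    have hcc : 𝒞 \ (𝒞 \ 𝒜) = 𝒜 := Finset.sdiff_sdiff_eq_self hsub
    rcases le_total 𝒜.card (𝒞 \ 𝒜).card with h | h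
    · exact ⟨𝒜, Finset.mem_filter.2 ⟨Finset.mem_powerset.2 hsub,
        Finset.ne_empty_of_mem hw₁, h⟩, hR⟩
    · refine ⟨𝒞 \ 𝒜, Finset.mem_filter.2 ⟨Finset.mem_powerset.2 Finset.sdiff_subset,
        Finset.ne_empty_of_mem hw₂, by rwa [hcc]⟩, ?_⟩
      intro a ha a' ha' hreach
      rw [hcc] at ha'
      exact hR a' ha' a ha hreach.symm
  have hterm : ∀ 𝒜 ∈ I, bernProb G.edgeFinset p (R 𝒜) ≤ Real.exp (-t) ^ 𝒜.card := by
    intro 𝒜 h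
    obtain ⟨hsub, _, hle⟩ := Finset.mem_filter.1 h
    rw [Finset.mem_powerset] at hsub
    have hle' : (𝒜.card : ℝ) ≤ (𝒞 \ 𝒜).card := by exact_mod_cast hle
    have := hG.bernProb_separated_le hd hb hp0 hp1 hP (r := r) (A := part 𝒜)
      (A' := part (𝒞 \ 𝒜)) (M := L * 𝒜.card) ?_ ?_ (hpart 𝒜 hsub)
      ((mul_le_mul_of_nonneg_left hle' hL).trans (hpart _ Finset.sdiff_subset))
    · refine this.trans ?_
      rw [← Real.exp_nat_mul]
      refine Real.exp_le_exp.2 ?_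
      have h1 := mul_le_mul_of_nonneg_left ht (Nat.cast_nonneg (α := ℝ) 𝒜.card)
      calc _ = -((𝒜.card : ℝ) *
            (p ^ (2 * r + 1) * (b * L / (d * ((d : ℝ) + 1) ^ (2 * (r + 1)))))) := by ring
        _ ≤ _ := by linarith
    · refine Finset.disjoint_left.2 fun v hv hv' => ?_
      exact (Finset.mem_sdiff.1 (mem_part.1 hv')).2 (mem_part.1 hv)
    · intro v
      obtain ⟨w, hw, hk⟩ := hnear v
      refine ⟨w, ?_, hw⟩
      by_cases hwA : mk w ∈ 𝒜
      · exact Finset.mem_union_left _ (mem_part.2 hwA)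
      · exact Finset.mem_union_right _ (mem_part.2 (Finset.mem_sdiff.2 ⟨mk_mem w hk, hwA⟩))
  have hcard : 𝒞.card ≤ Fintype.card V :=
    Finset.card_image_le.trans (Finset.card_le_univ _)
  have hexp : 0 < Real.exp (-t) := Real.exp_pos _
  calc _ ≤ ∑ 𝒜 ∈ I, bernProb G.edgeFinset p (R 𝒜) := bernProb_le_sum hp0 hp1 I R hbad
    _ ≤ ∑ 𝒜 ∈ I, Real.exp (-t) ^ 𝒜.card := Finset.sum_le_sum hterm
    _ ≤ ∑ 𝒜 ∈ 𝒞.powerset.erase ∅, Real.exp (-t) ^ 𝒜.card := by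
        refine Finset.sum_le_sum_of_subset_of_nonneg (fun 𝒜 h => ?_) fun _ _ _ => by positivity
        obtain ⟨h1, h2, _⟩ := Finset.mem_filter.1 h
        exact Finset.mem_erase.2 ⟨h2, h1⟩
    _ = (1 + Real.exp (-t)) ^ 𝒞.card - 1 := by
        have h1 := Finset.sum_pow_mul_eq_add_pow (Real.exp (-t)) 1 𝒞
        have h2 := Finset.add_sum_erase 𝒞.powerset (fun 𝒜 => Real.exp (-t) ^ 𝒜.card)
          (Finset.empty_mem_powerset 𝒞)
        simp only [one_pow, mul_one, Finset.card_empty, pow_zero] at h1 h2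
        rw [add_comm 1, ← h1, ← h2]
        ring
    _ ≤ _ := by
        gcongr
        linarith

/-- In a sparse expander, the large components of supercritical percolation are typically very
large and close to every vertex. -/
lemma isRegular.bernProb_not_gap_le {G : SimpleGraph V} {d : ℕ} (hG : isRegular G d)
    (hd : 0 < d) {b p q θ c L k₀ : ℝ} {m r : ℕ} (hb : 0 < b) (hq0 : 0 < q) (hqp : q ≤ p)
    (hp1 : p < 1) (hθ0 : 0 ≤ θ)
    (hθ : (1 + c) * Real.log (p / q) + ((d : ℝ) - 2 - 2 * c) * Real.log ((1 - p) / (1 - q)) ≤ -θ)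
    (hP₁ : ∀ U : Finset V, (U.card : ℝ) ≤ (Fintype.card V : ℝ) / 2 →
      b * U.card ≤ (edgesAcross G (U : Set V) : ℝ))
    (hP₂ : ∀ U : Finset V, (U.card : ℝ) ≤ L →
      (edgesWithin G (U : Set V) : ℝ) ≤ (1 + c) * U.card)
    (hkm : k₀ ≤ m) (hmL : m * k₀ ≤ L) (hmn : (m : ℝ) ≤ (Fintype.card V : ℝ) / 2)
    (hmr : (m : ℝ) ≤ (1 + b / d) ^ r) :
    bernProb G.edgeFinset p (fun S =>
      ¬ ((∀ v, k₀ ≤ compCard (SimpleGraph.fromEdgeSet (S : Set (Sym2 V))) v →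
        L ≤ compCard (SimpleGraph.fromEdgeSet (S : Set (Sym2 V))) v) ∧
      ∀ v, ∃ w ∈ walkBall G r v,
        k₀ ≤ compCard (SimpleGraph.fromEdgeSet (S : Set (Sym2 V))) w)) ≤
      2 * (Fintype.card V * Real.exp (-θ * k₀)) := by
  have hp0 : 0 ≤ p := (hq0.trans_le hqp).le
  have hball : ∀ v, ∃ B ⊆ walkBall G r v, B.card = m := fun v =>
    Finset.exists_subset_card_eq (by
      exact_mod_cast (le_min hmn hmr).trans (hG.le_card_walkBall hd hb hP₁ v r))
  choose B hBsub hBcard using hball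
  let R : Finset V → Finset (Sym2 V) → Prop := fun B S =>
    k₀ ≤ (openHull S B).card ∧ ((openHull S B).card : ℝ) ≤ L
  have hR : ∀ B, bernProb G.edgeFinset p (R B) ≤ Real.exp (-θ * k₀) := fun B =>
    bernProb_card_openHull_le hG hq0 hqp hp1 hθ0 hθ hP₂ B
  have hsum : ∀ C : V → Finset V, ∑ v, bernProb G.edgeFinset p (R (C v)) ≤
      Fintype.card V * Real.exp (-θ * k₀) := fun C =>
    (Finset.sum_le_sum fun v _ => hR (C v)).trans (by simp)
  refine (bernProb_or_le hp0 hp1.le (Q₁ := fun S => ∃ v ∈ Finset.univ, R {v} S)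
    (Q₂ := fun S => ∃ v ∈ Finset.univ, R (B v) S) fun S _ h => ?_).trans ?_
  · rw [not_and_or] at h
    push Not at h
    rcases h with ⟨v, h1, h2⟩ | ⟨v, h⟩
    · rw [compCard_eq_card_openHull] at h1 h2
      exact Or.inl ⟨v, Finset.mem_univ v, h1, h2.le⟩
    · refine Or.inr ⟨v, Finset.mem_univ v, ?_, ?_⟩
      · have := Finset.card_le_card (subset_openHull S (B v))
        rw [hBcard] at this
        exact hkm.trans (by exact_mod_cast this)
      · calc ((openHull S (B v)).card : ℝ) ≤
            ∑ u ∈ B v, (compCard (SimpleGraph.fromEdgeSet (S : Set (Sym2 V))) u : ℝ) := by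
              exact_mod_cast card_openHull_le_sum S (B v)
          _ ≤ ∑ u ∈ B v, k₀ := Finset.sum_le_sum fun u hu => (h u (hBsub v hu)).le
          _ = m * k₀ := by simp [hBcard]
          _ ≤ L := hmL
  · have h1 := bernProb_le_sum (E := G.edgeFinset) hp0 hp1.le Finset.univ
      (fun (v : V) => R {v}) (Q := fun S => ∃ v ∈ Finset.univ, R {v} S) fun S _ h => h
    have h2 := bernProb_le_sum (E := G.edgeFinset) hp0 hp1.le Finset.univ
      (fun (v : V) => R (B v)) (Q := fun S => ∃ v ∈ Finset.univ, R (B v) S) fun S _ h => h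
    linarith [hsum fun v => {v}, hsum B]

lemma percProb2_ge {G : SimpleGraph V} {p₁ p₂ η₁ η₂ : ℝ} (hp0 : 0 ≤ p₁) (hp1 : p₁ ≤ 1)
    (hq0 : 0 ≤ p₂) (hq1 : p₂ ≤ 1)
    (P : Finset (Sym2 V) → Prop) (Q : Finset (Sym2 V) → Finset (Sym2 V) → Prop)
    (h₁ : bernProb G.edgeFinset p₁ (fun S => ¬ P S) ≤ η₁)
    (h₂ : ∀ S, P S → bernProb G.edgeFinset p₂ (fun S' => ¬ Q S S') ≤ η₂) (hη : 0 ≤ η₂) :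
    1 - (η₁ + η₂) ≤ percProb2 G p₁ p₂ Q := by
  have e : percProb2 G p₁ p₂ Q =
      ∑ S ∈ G.edgeFinset.powerset, bernWeight G.edgeFinset p₁ S *
        bernProb G.edgeFinset p₂ (Q S) := by
    unfold percProb2 bernProb
    refine Finset.sum_congr rfl fun S _ => ?_
    rw [Finset.mul_sum]
    refine Finset.sum_congr rfl fun S' _ => ?_
    split_ifs
    · rfl
    · simp
  have hle : ∀ S ∈ G.edgeFinset.powerset, bernWeight G.edgeFinset p₁ S * (1 - η₂) -
      (if ¬ P S then bernWeight G.edgeFinset p₁ S else 0) ≤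
      bernWeight G.edgeFinset p₁ S * bernProb G.edgeFinset p₂ (Q S) := by
    intro S _
    have hw := bernWeight_nonneg (E := G.edgeFinset) hp0 hp1 S
    have hn := bernProb_nonneg (E := G.edgeFinset) hq0 hq1 (Q S)
    by_cases hS : P S
    · have h := h₂ S hS
      have h' := bernProb_add_not G.edgeFinset p₂ (Q S)
      rw [if_neg (not_not.2 hS), sub_zero]
      exact mul_le_mul_of_nonneg_left (by linarith) hw
    · rw [if_pos hS]
      nlinarith [mul_nonneg hw hn, mul_nonneg hw hη]
  rw [e]
  refine le_trans ?_ (Finset.sum_le_sum hle)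
  rw [Finset.sum_sub_distrib, ← Finset.sum_mul, sum_bernWeight]
  have : ∑ S ∈ G.edgeFinset.powerset, (if ¬ P S then bernWeight G.edgeFinset p₁ S else 0) ≤ η₁ := by
    unfold bernProb at h₁
    convert h₁
  linarith

end Merge

section Parameters

open Filter Topology

lemma log_one_add_le {x : ℝ} (hx : 0 ≤ x) : Real.log (1 + x) ≤ x - x ^ 2 / (2 * (1 + x)) := by
  have hmono : MonotoneOn (fun y : ℝ => y - y ^ 2 / (2 * (1 + y)) - Real.log (1 + y))
      (Set.Ici 0) := by
    have hder : ∀ y : ℝ, 0 ≤ y →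
        HasDerivAt (fun y : ℝ => y - y ^ 2 / (2 * (1 + y)) - Real.log (1 + y))
          (y ^ 2 / (2 * (1 + y) ^ 2)) y := by
      intro y hy
      have h1 : HasDerivAt (fun y : ℝ => 1 + y) 1 y := (hasDerivAt_id y).const_add 1
      have h2 := ((hasDerivAt_id y).sub (((hasDerivAt_id y).pow 2).div (h1.const_mul 2)
        (by positivity))).sub (h1.log (by positivity))
      refine HasDerivAt.congr_deriv h2 ?_
      simp only [id, Pi.pow_apply]
      field_simp
      norm_num
      ring
    refine monotoneOn_of_deriv_nonneg (convex_Ici 0)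
      (fun y hy => (hder y hy).continuousAt.continuousWithinAt)
      (fun y hy => (hder y (interior_subset hy)).differentiableAt.differentiableWithinAt)
      fun y hy => ?_
    rw [(hder y (interior_subset hy)).deriv]
    positivity
  have := hmono (Set.mem_Ici.2 le_rfl) (Set.mem_Ici.2 hx) hx
  simp only [add_zero, Real.log_one] at this
  norm_num at this
  linarith

/-- The large-deviation rate at criticality `1 / (d - 1)` versus `lam / (d - 1)`. -/
lemma rate_le {D lam : ℝ} (hlam₁ : 1 < lam) (hlam₂ : lam < D) :
    Real.log (lam / D / (1 / D)) + (D - 1) * Real.log ((1 - lam / D) / (1 - 1 / D)) ≤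
      -((lam - 1) ^ 2 / (2 * lam)) := by
  have hD : 0 < D := by linarith
  have hD1 : 0 < D - 1 := by linarith
  have e1 : lam / D / (1 / D) = 1 + (lam - 1) := by field_simp; ring
  have e2 : (1 - lam / D) / (1 - 1 / D) = (D - lam) / (D - 1) := by field_simp
  have h1 := log_one_add_le (x := lam - 1) (by linarith)
  have h2 := Real.log_le_sub_one_of_pos (x := (D - lam) / (D - 1))
    (div_pos (by linarith) hD1)
  have h3 : (D - 1) * ((D - lam) / (D - 1) - 1) = 1 - lam := by
    field_simp
    ring
  have h4 := mul_le_mul_of_nonneg_left h2 hD1.le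
  rw [h3] at h4
  rw [e1, e2]
  rw [show 1 + (lam - 1) = lam by ring] at h1 ⊢
  linarith

/-- Small sparsity excess and sprinkling preserve the large-deviation rate up to a factor. -/
lemma exists_sprinkling {D lam : ℝ} (hlam₁ : 1 < lam) (hlam₂ : lam < D) :
    ∃ τ > 0, 1 < lam - τ ∧ τ < D ∧ 1 / D < 1 - (1 - lam / D) / (1 - τ / D) ∧
      (1 + τ) * Real.log ((1 - (1 - lam / D) / (1 - τ / D)) / (1 / D)) +
        (D + 1 - 2 - 2 * τ) *
          Real.log ((1 - (1 - (1 - lam / D) / (1 - τ / D))) / (1 - 1 / D)) ≤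
        -(2 * (lam - 1) ^ 2 / (5 * lam)) := by
  have hD : 0 < D := by linarith
  have hD1 : 1 - 1 / D ≠ 0 := by
    have : 1 / D < 1 := (div_lt_one hD).2 (by linarith)
    linarith
  have hlD : lam / D < 1 := (div_lt_one hD).2 hlam₂
  have hl : 0 < lam - 1 := by linarith
  have cP : ContinuousAt (fun τ : ℝ => 1 - (1 - lam / D) / (1 - τ / D)) 0 := by
    refine continuousAt_const.sub (continuousAt_const.div ?_ (by simp))
    fun_prop
  have cF : ContinuousAt (fun τ : ℝ =>
      (1 + τ) * Real.log ((1 - (1 - lam / D) / (1 - τ / D)) / (1 / D)) +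
        (D + 1 - 2 - 2 * τ) *
          Real.log ((1 - (1 - (1 - lam / D) / (1 - τ / D))) / (1 - 1 / D))) 0 := by
    refine ContinuousAt.add (ContinuousAt.mul (by fun_prop) ?_) (ContinuousAt.mul (by fun_prop) ?_)
    · refine (cP.div_const _).log ?_
      have : lam / D / (1 / D) ≠ 0 := by positivity
      simpa using this
    · refine ((continuousAt_const.sub cP).div_const _).log ?_
      have : (1 - lam / D) / (1 - 1 / D) ≠ 0 := div_ne_zero (by linarith) hD1
      simpa using this
  have hrate := rate_le hlam₁ hlam₂
  have e1 : ∀ᶠ τ : ℝ in 𝓝 0, 1 / D < 1 - (1 - lam / D) / (1 - τ / D) := by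
    refine cP.eventually_const_lt ?_
    have : 1 / D < lam / D := by gcongr
    simpa using this
  have e2 := cF.eventually_lt (g := fun _ => -(2 * (lam - 1) ^ 2 / (5 * lam)))
    continuousAt_const (by
      have : 2 * (lam - 1) ^ 2 / (5 * lam) < (lam - 1) ^ 2 / (2 * lam) := by
        rw [div_lt_div_iff₀ (by positivity) (by positivity)]
        nlinarith [mul_pos (pow_pos hl 2) (by linarith : (0 : ℝ) < lam)]
      have hs : D + 1 - 2 = D - 1 := by ring
      simp only [add_zero, zero_div, sub_zero, div_one, mul_zero, one_mul, sub_sub_cancel, hs]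
      linarith)
  have e3 : ∀ᶠ τ : ℝ in 𝓝 0, τ < lam - 1 := eventually_lt_nhds hl
  have e4 : ∀ᶠ τ : ℝ in 𝓝 0, τ < D := eventually_lt_nhds hD
  have hev := (((e1.and e2).and (e3.and e4)).filter_mono nhdsWithin_le_nhds).and
    (self_mem_nhdsWithin : Set.Ioi (0 : ℝ) ∈ 𝓝[>] 0)
  obtain ⟨τ, ⟨⟨h1, h2⟩, h3, h4⟩, h5⟩ := hev.exists
  exact ⟨τ, h5, by linarith, h4, h1, h2.le⟩

/-- Growth conditions satisfied by `x = log n`. -/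
lemma eventually_growth {K b d p : ℝ} (hK : 0 < K) (hb : 0 < b) (hd : 0 < d) (hp0 : 0 < p)
    (hp1 : p ≤ 1) :
    ∃ C > (0 : ℝ), ∀ᶠ x : ℝ in atTop, ∃ m r : ℕ, 0 ≤ x ∧ K * x ≤ m ∧ m * (K * x) ≤ x ^ C ∧
      (m : ℝ) ≤ Real.exp x / 2 ∧ (m : ℝ) ≤ (1 + b / d) ^ r ∧
      2 * x ≤ p ^ (2 * r + 1) * (b * x ^ C / (d * (d + 1) ^ (2 * (r + 1)))) := by
  set β := Real.log (1 + b / d) with hβ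
  have hbd : 0 < b / d := by positivity
  have hβ0 : 0 < β := Real.log_pos (by linarith)
  set κ := p / (d + 1) with hκ
  have hκ0 : 0 < κ := by positivity
  have hκ1 : κ < 1 := (div_lt_one (by positivity)).2 (by linarith)
  set l := -Real.log κ with hl
  have hl0 : 0 < l := by
    have := Real.log_neg hκ0 hκ1
    linarith
  have hκl : κ = Real.exp (-l) := by rw [hl, neg_neg, Real.exp_log hκ0]
  refine ⟨4 * l / β + 4, by positivity, ?_⟩
  have hexp : ∀ᶠ x : ℝ in atTop, 2 * x ^ 2 ≤ Real.exp x := by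
    filter_upwards [(Real.tendsto_exp_div_pow_atTop 2).eventually_ge_atTop 2,
      eventually_gt_atTop 0] with x hx hx0
    rwa [le_div_iff₀ (by positivity)] at hx
  filter_upwards [hexp, eventually_ge_atTop (K + 1), eventually_ge_atTop 1,
    eventually_ge_atTop (2 / (b * Real.exp (-(5 * l))))] with x h1 h2 h3 h4
  have hx0 : 0 < x := by linarith
  have hlog : 0 ≤ Real.log x := Real.log_nonneg h3
  set r := ⌈2 * Real.log x / β⌉₊ with hr
  have hr1 : 2 * Real.log x / β ≤ r := Nat.le_ceil _
  have hr2 : (r : ℝ) ≤ 2 * Real.log x / β + 1 :=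
    (Nat.ceil_lt_add_one (by positivity)).le
  have hm : (⌊x ^ 2⌋₊ : ℝ) ≤ x ^ 2 := Nat.floor_le (by positivity)
  have hxC : x ^ (4 * l / β + 4) = Real.exp (4 * l / β * Real.log x) * x ^ 4 := by
    rw [Real.rpow_add hx0, Real.rpow_def_of_pos hx0, mul_comm (Real.log x)]
    norm_cast
  refine ⟨⌊x ^ 2⌋₊, r, hx0.le, ?_, ?_, by linarith, hm.trans ?_, ?_⟩
  · have := Nat.lt_floor_add_one (x ^ 2)
    nlinarith
  · have hge : (1 : ℝ) ≤ Real.exp (4 * l / β * Real.log x) :=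
      Real.one_le_exp (by positivity)
    rw [hxC]
    calc (⌊x ^ 2⌋₊ : ℝ) * (K * x) ≤ x ^ 2 * (x * x) := by
          gcongr
          linarith
      _ = 1 * x ^ 4 := by ring
      _ ≤ _ := by gcongr
  · rw [div_le_iff₀ hβ0] at hr1
    calc x ^ 2 = Real.exp (2 * Real.log x) := by
          rw [← Real.exp_log (pow_pos hx0 2), Real.log_pow]
          norm_num
      _ ≤ Real.exp (r * β) := Real.exp_le_exp.2 hr1
      _ = _ := by rw [Real.exp_nat_mul, hβ, Real.exp_log (by linarith)]
  · have hpow : κ ^ (2 * r + 3) ≤ p ^ (2 * r + 1) / (d * (d + 1) ^ (2 * (r + 1))) := by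
      rw [hκ, div_pow]
      have : p ^ (2 * r + 3) ≤ p ^ (2 * r + 1) :=
        pow_le_pow_of_le_one hp0.le hp1 (by omega)
      gcongr
      rw [show 2 * r + 3 = 2 * (r + 1) + 1 by ring, pow_succ']
      gcongr
      linarith
    have hκr : Real.exp (-(5 * l)) * Real.exp (-(4 * l / β * Real.log x)) ≤ κ ^ (2 * r + 3) := by
      rw [hκl, ← Real.exp_nat_mul, ← Real.exp_add]
      refine Real.exp_le_exp.2 ?_
      push_cast
      have := mul_le_mul_of_nonneg_right hr2 hl0.le
      have e : 4 * l / β * Real.log x = 2 * (2 * Real.log x / β * l) := by ring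
      rw [e]
      nlinarith
    have hb5 : 0 < b * Real.exp (-(5 * l)) := by positivity
    have h4' : 2 ≤ b * Real.exp (-(5 * l)) * x := by
      rw [div_le_iff₀ hb5] at h4
      linarith
    have hx3 : x ≤ x ^ 3 := by nlinarith [mul_pos hx0 hx0]
    calc 2 * x ≤ b * Real.exp (-(5 * l)) * x * x ^ 3 := by gcongr
      _ = (Real.exp (-(5 * l)) * Real.exp (-(4 * l / β * Real.log x))) *
          (b * (Real.exp (4 * l / β * Real.log x) * x ^ 4)) := by
          rw [Real.exp_neg (4 * l / β * Real.log x)]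
          field_simp
      _ ≤ p ^ (2 * r + 1) / (d * (d + 1) ^ (2 * (r + 1))) *
          (b * (Real.exp (4 * l / β * Real.log x) * x ^ 4)) :=
          mul_le_mul_of_nonneg_right (hκr.trans hpow) (by positivity)
      _ = _ := by rw [hxC]; ring

lemma eventually_error_le {ε : ℝ} (hε : 0 < ε) :
    ∀ᶠ n : ℕ in atTop, 2 * ((n : ℝ) * Real.exp (-(2 * Real.log n))) +
      ((1 + Real.exp (-(2 * Real.log n))) ^ n - 1) ≤ ε := by
  have h0 : Tendsto (fun n : ℕ => ((n : ℝ))⁻¹) atTop (𝓝 0) := tendsto_inv_atTop_nhds_zero_nat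
  have h1 : Tendsto (fun n : ℕ => 2 * ((n : ℝ))⁻¹ + (Real.exp ((n : ℝ)⁻¹) - 1)) atTop (𝓝 0) := by
    have := (h0.const_mul 2).add (((Real.continuous_exp.tendsto 0).comp h0).sub_const 1)
    simpa using this
  filter_upwards [h1.eventually_lt_const hε, eventually_gt_atTop 0] with n hn hn0
  have hn' : (0 : ℝ) < n := by exact_mod_cast hn0
  have e : (n : ℝ) * Real.exp (-(2 * Real.log n)) = (n : ℝ)⁻¹ := by
    rw [Real.exp_neg, mul_comm 2, Real.exp_mul, Real.exp_log hn']
    norm_num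
    field_simp
  have hpow : (1 + Real.exp (-(2 * Real.log n))) ^ n ≤ Real.exp ((n : ℝ)⁻¹) := by
    rw [← e, Real.exp_nat_mul]
    refine pow_le_pow_left₀ (by positivity) ?_ n
    rw [add_comm]
    exact Real.add_one_le_exp _
  rw [e]
  linarith

end Parameters

/-- Sprinkling setup as in the paper: `d ≥ 3`, `1 < λ < d-1`,
`p = λ/(d-1)`, `δ > 0` with `λ - δ > 1`, `p₂ = δ/(d-1)`, `(1-p₁)(1-p₂) = 1-p`;
`G₁ = G_{p₁}`, `G₂ = G_{p₁} ∪ G_{p₂}`, and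
`W = {v : |C_{G₁}(v)| ≥ 5λ log n/(λ-1)²}`. Let `b > 0`. There exist constants `c, δ > 0` and
`C > 0` such that for every `ε > 0` there is `n₀`: for every `n ≥ n₀` and every `d`-regular
graph `G` on `n` vertices satisfying (P1) and (P2), with probability at least `1-ε` there is
a single connected component `K` of `G₂` with `W ⊆ V(K)` (equivalently, every two vertices of
`W` are connected in `G₂`). -/
theorem statement_12 (d : ℕ) (hd : 3 ≤ d) (lam : ℝ) (hlam₁ : 1 < lam)
    (hlam₂ : lam < (d : ℝ) - 1) (p : ℝ) (hp : p = lam / ((d : ℝ) - 1))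
    (b : ℝ) (hb : 0 < b) :
    ∃ c > (0 : ℝ), ∃ δ : ℝ, (0 < δ ∧ 1 < lam - δ) ∧ ∃ C > (0 : ℝ),
    ∀ p₁ p₂ : ℝ, p₂ = δ / ((d : ℝ) - 1) → (1 - p₁) * (1 - p₂) = 1 - p →
    ∀ ε > (0 : ℝ), ∃ n₀ : ℕ, ∀ n : ℕ, n₀ ≤ n →
    ∀ G : SimpleGraph (Fin n), isRegular G d →
    (∀ U : Set (Fin n), (U.ncard : ℝ) ≤ n / 2 →
      b * U.ncard ≤ (edgesAcross G U : ℝ)) →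
    (∀ U : Set (Fin n), (U.ncard : ℝ) ≤ Real.log n ^ C →
      (edgesWithin G U : ℝ) ≤ (1 + c) * U.ncard) →
    1 - ε ≤ percProb2 G p₁ p₂ (fun S₁ S₂ =>
      ∀ w₁ w₂ : Fin n,
        5 * lam * Real.log n / (lam - 1) ^ 2
            ≤ (compCard (SimpleGraph.fromEdgeSet (↑S₁ : Set (Sym2 (Fin n)))) w₁ : ℝ) →
        5 * lam * Real.log n / (lam - 1) ^ 2
            ≤ (compCard (SimpleGraph.fromEdgeSet (↑S₁ : Set (Sym2 (Fin n)))) w₂ : ℝ) →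
        (SimpleGraph.fromEdgeSet (↑(S₁ ∪ S₂) : Set (Sym2 (Fin n)))).Reachable w₁ w₂) := by
  have hd0 : 0 < d := by omega
  have hd' : (0 : ℝ) < d := by exact_mod_cast hd0
  have hD : (0 : ℝ) < (d : ℝ) - 1 := by linarith
  obtain ⟨τ, hτ0, hτ1, hτD, hqp, hrate⟩ := exists_sprinkling hlam₁ hlam₂
  have hl : 0 < lam - 1 := by linarith
  have hτp0 : 0 < τ / ((d : ℝ) - 1) := by positivity
  have hτp1 : τ / ((d : ℝ) - 1) < 1 := (div_lt_one hD).2 hτD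
  set K := 5 * lam / (lam - 1) ^ 2 with hK
  have hK0 : 0 < K := by positivity
  obtain ⟨C, hC, hgrowth⟩ := eventually_growth hK0 hb hd' hτp0 hτp1.le
  refine ⟨τ, hτ0, τ, ⟨hτ0, hτ1⟩, C, hC, ?_⟩
  rintro p₁ p₂ rfl hp₁ ε hε
  have hp₁' : p₁ = 1 - (1 - lam / ((d : ℝ) - 1)) / (1 - τ / ((d : ℝ) - 1)) := by
    rw [hp] at hp₁
    rw [← hp₁, mul_div_cancel_right₀ _ (by linarith)]
    ring
  rw [← hp₁'] at hqp hrate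
  have hp₁1 : p₁ < 1 := by
    have h1 : lam / ((d : ℝ) - 1) < 1 := (div_lt_one hD).2 hlam₂
    have : 0 < (1 - lam / ((d : ℝ) - 1)) / (1 - τ / ((d : ℝ) - 1)) :=
      div_pos (by linarith) (by linarith)
    linarith
  have hq0 : 0 < 1 / ((d : ℝ) - 1) := by positivity
  have hlogn : Filter.Tendsto (fun n : ℕ => Real.log n) Filter.atTop Filter.atTop :=
    Real.tendsto_log_atTop.comp tendsto_natCast_atTop_atTop
  obtain ⟨n₀, hn₀⟩ := Filter.eventually_atTop.1 (((hlogn.eventually hgrowth).and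
    (eventually_error_le hε)).and (Filter.eventually_gt_atTop 0))
  refine ⟨n₀, fun n hn G hG hP₁ hP₂ => ?_⟩
  obtain ⟨⟨⟨m, r, hx0, hkm, hmL, hmn, hmr, ht⟩, herr⟩, hnpos⟩ := hn₀ n hn
  rw [Real.exp_log (by exact_mod_cast hnpos)] at hmn
  have hP₁' : ∀ U : Finset (Fin n), (U.card : ℝ) ≤ (Fintype.card (Fin n) : ℝ) / 2 →
      b * U.card ≤ (edgesAcross G (U : Set (Fin n)) : ℝ) := fun U hU => by
    have := hP₁ U
    rw [Set.ncard_coe_finset] at this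
    exact this (by simpa using hU)
  have hP₂' : ∀ U : Finset (Fin n), (U.card : ℝ) ≤ Real.log n ^ C →
      (edgesWithin G (U : Set (Fin n)) : ℝ) ≤ (1 + τ) * U.card := fun U hU => by
    have := hP₂ U
    rw [Set.ncard_coe_finset] at this
    exact this hU
  have hkeq : 5 * lam * Real.log n / (lam - 1) ^ 2 = K * Real.log n := by
    rw [hK]
    ring
  have hθK : -(2 * (lam - 1) ^ 2 / (5 * lam)) * (K * Real.log n) = -(2 * Real.log n) := by
    rw [hK]
    field_simp
  have hgap := hG.bernProb_not_gap_le hd0 (m := m) (r := r) (k₀ := K * Real.log n) hb hq0 hqp.le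
    hp₁1 (θ := 2 * (lam - 1) ^ 2 / (5 * lam)) (by positivity)
    (by rw [show (d : ℝ) - 2 - 2 * τ = (d : ℝ) - 1 + 1 - 2 - 2 * τ by ring]; exact hrate)
    hP₁' hP₂' hkm hmL (by simpa using hmn) hmr
  rw [hθK, Fintype.card_fin] at hgap
  have hη : 0 ≤ (1 + Real.exp (-(2 * Real.log n))) ^ n - 1 := by
    have := one_le_pow₀ (n := n) (a := 1 + Real.exp (-(2 * Real.log n)))
      (by linarith [Real.exp_pos (-(2 * Real.log n))])
    linarith
  rw [hkeq]
  refine le_trans (by linarith) (percProb2_ge (hq0.le.trans hqp.le) hp₁1.le hτp0.le hτp1.le _ _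
    hgap (fun S hS => ?_) hη)
  have hmerge := hG.bernProb_not_merged_le hd0 hb hτp0.le hτp1.le hP₁'
    (Real.rpow_nonneg hx0 C) ht S hS.1 hS.2
  rw [Fintype.card_fin] at hmerge
  simpa only [Finset.coe_union] using hmerge
end

section
/- Assume the sprinkling setup. There exist constants c > 0, δ > 0 (sufficiently small with respect to λ-1 and d) and C > 0 (sufficiently large) such that for every ε > 0 there exists n_0 with the following property: for every n ≥ n_0 and every d-regular graph G on n vertices satisfying (P2), with probability at least 1-ε there is no connected component of G_2 = G_{p_1} ∪ G_{p_2} of order at least log^C n whose vertex set is disjoint from W. -/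
open scoped Classical

/-- `IsSubtree v U T`: the edges `T` form a tree on the vertex set `U`, grown from the root `v` by
adding one leaf at a time. -/
inductive IsSubtree {V : Type*} (v : V) : Finset V → Finset (Sym2 V) → Prop
  | root : IsSubtree v {v} ∅
  | leaf {U : Finset V} {T : Finset (Sym2 V)} {x y : V} (h : IsSubtree v U T) (hx : x ∈ U)
      (hy : y ∉ U) : IsSubtree v (insert y U) (insert s(x, y) T)

namespace IsSubtree

variable {V : Type*} {v : V} {U D : Finset V} {S T : Finset (Sym2 V)}

lemma root_mem (h : IsSubtree v U T) : v ∈ U := by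
  induction h with
  | root => simp
  | leaf _ _ _ ih => exact Finset.mem_insert_of_mem ih

lemma mem_of_mem_edge (h : IsSubtree v U T) : ∀ e ∈ T, ∀ a ∈ e, a ∈ U := by
  induction h with
  | root => simp
  | @leaf U T x y h hx hy ih =>
    intro e he a ha
    rcases Finset.mem_insert.1 he with rfl | he
    · rcases Sym2.mem_iff.1 ha with rfl | rfl <;> simp [hx]
    · exact Finset.mem_insert_of_mem (ih e he a ha)

lemma card_add_one (h : IsSubtree v U T) : T.card + 1 = U.card := by
  induction h with
  | root => simp
  | @leaf U T x y h hx hy ih =>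
    have : s(x, y) ∉ T := fun he => hy (h.mem_of_mem_edge _ he y (by simp))
    rw [Finset.card_insert_of_notMem this, Finset.card_insert_of_notMem hy, ih]

lemma subset_of_closed (h : IsSubtree v U T) {Y : Set V} (hv : v ∈ Y)
    (hY : ∀ a ∈ Y, ∀ b, s(a, b) ∈ T → b ∈ Y) : ∀ a ∈ U, a ∈ Y := by
  induction h with
  | root => simpa using hv
  | @leaf U T x y h hx hy ih =>
    have hU := ih fun a ha b hb => hY a ha b (Finset.mem_insert_of_mem hb)
    intro a ha
    rcases Finset.mem_insert.1 ha with rfl | ha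
    · exact hY x (hU x hx) _ (Finset.mem_insert_self _ _)
    · exact hU a ha

lemma exists_extension (h : IsSubtree v U T) (hTS : T ⊆ S) (hUD : U ⊆ D)
    (hD : ∀ Y, U ⊆ Y → Y ⊂ D → ∃ x ∈ Y, ∃ y ∈ D, y ∉ Y ∧ s(x, y) ∈ S) :
    ∃ T' ⊆ S, IsSubtree v D T' := by
  induction hk : (D \ U).card using Nat.strong_induction_on generalizing U T with
  | _ k ih =>
    by_cases hUD' : U = D
    · exact ⟨T, hTS, hUD' ▸ h⟩
    obtain ⟨x, hx, y, hyD, hyU, hxy⟩ := hD U subset_rfl (hUD.ssubset_of_ne hUD')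
    refine ih _ ?_ (h.leaf hx hyU) (Finset.insert_subset hxy hTS)
      (Finset.insert_subset hyD hUD)
      (fun Y hY => hD Y ((Finset.subset_insert _ _).trans hY)) rfl
    rw [← hk]
    refine Finset.card_lt_card ⟨Finset.sdiff_subset_sdiff subset_rfl (Finset.subset_insert _ _),
      fun hsub => ?_⟩
    have := hsub (Finset.mem_sdiff.2 ⟨hyD, hyU⟩)
    simp at this

end IsSubtree

lemma SimpleGraph.Reachable.exists_boundary_adj {V : Type*} {H : SimpleGraph V} {x y : V}
    (h : H.Reachable x y) {Y : Set V} (hx : x ∈ Y) (hy : y ∉ Y) :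
    ∃ a b, H.Reachable x a ∧ a ∈ Y ∧ b ∉ Y ∧ H.Adj a b := by
  obtain ⟨w⟩ := h
  obtain ⟨e, he, h1, h2⟩ := w.exists_boundary_dart Y hx hy
  exact ⟨e.fst, e.snd, ⟨w.takeUntil _ (w.dart_fst_mem_support_of_mem_darts he)⟩, h1, h2, e.adj⟩

/-- If the component of `v` in `S` has at least `L` vertices but is made of components of
`S₁ ⊆ S` with fewer than `K` vertices, then it contains an `S₁`-closed tree with between `L` and
`L + K` vertices. -/
lemma exists_isSubtree_closed {V : Type*} [Fintype V] {S₁ S : Finset (Sym2 V)} (hS : S₁ ⊆ S)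
    (v : V) {L K : ℝ} (hL : 0 ≤ L)
    (hbig : L ≤ compCard (SimpleGraph.fromEdgeSet (↑S : Set (Sym2 V))) v)
    (hsmall : ∀ u, (SimpleGraph.fromEdgeSet (↑S : Set (Sym2 V))).Reachable v u →
      (compCard (SimpleGraph.fromEdgeSet (↑S₁ : Set (Sym2 V))) u : ℝ) < K) :
    ∃ U T, IsSubtree v U T ∧ T ⊆ S ∧ (∀ x ∈ U, ∀ y, s(x, y) ∈ S₁ → y ∈ U) ∧
      L ≤ U.card ∧ (U.card : ℝ) ≤ L + K := by
  set H := SimpleGraph.fromEdgeSet (↑S : Set (Sym2 V)) with hH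
  set H₁ := SimpleGraph.fromEdgeSet (↑S₁ : Set (Sym2 V)) with hH₁
  let comp (x : V) : Finset V := Finset.univ.filter (H₁.Reachable x)
  have hcomp (x : V) : (comp x).card = compCard H₁ x := by
    rw [compCard, Set.ncard_eq_toFinset_card']
    congr 1
    ext; simp [comp]
  have hcompH : (Finset.univ.filter (H.Reachable v)).card = compCard H v := by
    rw [compCard, Set.ncard_eq_toFinset_card']
    congr 1
    ext; simp
  have hstep (a b : V) (h : s(a, b) ∈ S₁) : H₁.Reachable a b := by
    by_cases hab : a = b
    · rw [hab]
    · exact SimpleGraph.Adj.reachable ((SimpleGraph.fromEdgeSet_adj _).2 ⟨by simpa using h, hab⟩)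
  let P (U : Finset V) : Prop := (∃ T ⊆ S, IsSubtree v U T) ∧
    (∀ x ∈ U, ∀ y, s(x, y) ∈ S₁ → y ∈ U) ∧ (U.card : ℝ) ≤ L + K
  have hgrow (U : Finset V) (T : Finset (Sym2 V)) (hT : IsSubtree v U T) (hTS : T ⊆ S) (x : V)
      (hx : x ∈ U ∨ ∃ a ∈ U, s(a, x) ∈ S) : ∃ T' ⊆ S, IsSubtree v (U ∪ comp x) T' := by
    refine hT.exists_extension hTS Finset.subset_union_left fun Y hUY hY => ?_
    by_cases hxY : x ∈ Y
    · obtain ⟨y, hy, hyY⟩ := Finset.exists_of_ssubset hY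
      have hxy : H₁.Reachable x y := by
        rcases Finset.mem_union.1 hy with hy | hy
        · exact absurd (hUY hy) hyY
        · simpa [comp] using hy
      obtain ⟨a, b, hxa, ha, hb, hab⟩ := hxy.exists_boundary_adj (Y := (↑Y : Set V))
        (by simpa using hxY) (by simpa using hyY)
      refine ⟨a, by simpa using ha, b, ?_, by simpa using hb, hS ?_⟩
      · exact Finset.mem_union_right _ (by simpa [comp] using hxa.trans hab.reachable)
      · simpa using ((SimpleGraph.fromEdgeSet_adj _).1 hab).1
    · obtain hx | ⟨a, ha, hax⟩ := hx
      · exact absurd (hUY hx) hxY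
      · exact ⟨a, hUY ha, x, Finset.mem_union_right _ (by simp [comp]), hxY, hax⟩
  have hclosed (x : V) : ∀ a ∈ comp x, ∀ b, s(a, b) ∈ S₁ → b ∈ comp x := by
    intro a ha b hab
    have ha' : H₁.Reachable x a := by simpa [comp] using ha
    simpa [comp] using ha'.trans (hstep a b hab)
  have hP0 : P (comp v) := by
    refine ⟨?_, hclosed v, ?_⟩
    · have := hgrow {v} ∅ .root (by simp) v (by simp)
      rwa [Finset.union_eq_right.2 (by simp [comp])] at this
    · rw [hcomp]
      linarith [hsmall v (SimpleGraph.Reachable.refl _)]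
  obtain ⟨U, hU, hmax⟩ := Finset.exists_max_image (Finset.univ.filter P) Finset.card
    ⟨comp v, by simpa using hP0⟩
  obtain ⟨⟨T, hTS, hT⟩, hUc, hUcard⟩ : P U := by simpa using hU
  refine ⟨U, T, hT, hTS, hUc, ?_, hUcard⟩
  by_contra! hlt
  have hUH : ∀ a ∈ U, H.Reachable v a := by
    refine hT.subset_of_closed (Y := {a | H.Reachable v a}) (SimpleGraph.Reachable.refl _) ?_
    intro a ha b hab
    by_cases hne : a = b
    · rwa [← hne]
    · exact SimpleGraph.Reachable.trans ha (SimpleGraph.Adj.reachable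
        ((SimpleGraph.fromEdgeSet_adj _).2 ⟨by simpa using hTS hab, hne⟩))
  obtain ⟨z, hz, hzU⟩ : ∃ z, H.Reachable v z ∧ z ∉ U := by
    by_contra! hall
    have : (Finset.univ.filter (H.Reachable v)).card ≤ U.card :=
      Finset.card_le_card fun a ha => hall a (by simpa using ha)
    rw [hcompH] at this
    have : (compCard H v : ℝ) ≤ U.card := by exact_mod_cast this
    linarith
  obtain ⟨a, x, hva, ha, hx, hax⟩ := hz.exists_boundary_adj (Y := (↑U : Set V))
    (by simpa using hT.root_mem) (by simpa using hzU)
  have hPn : P (U ∪ comp x) := by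
    refine ⟨hgrow U T hT hTS x (.inr ⟨a, by simpa using ha, ?_⟩), ?_, ?_⟩
    · simpa using ((SimpleGraph.fromEdgeSet_adj _).1 hax).1
    · intro b hb y hby
      rcases Finset.mem_union.1 hb with hb | hb
      · exact Finset.mem_union_left _ (hUc b hb y hby)
      · exact Finset.mem_union_right _ (hclosed x b hb y hby)
    · have h1 : ((U ∪ comp x).card : ℝ) ≤ U.card + (comp x).card := by
        exact_mod_cast Finset.card_union_le _ _
      have h2 := hsmall x (hva.trans hax.reachable)
      rw [← hcomp] at h2
      linarith
  have := hmax _ (by simpa using hPn)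
  refine absurd this (not_le.2 (Finset.card_lt_card ⟨Finset.subset_union_left, fun h => hx ?_⟩))
  exact Finset.mem_coe.2 (h (Finset.mem_union_right _ (by simp [comp])))

section Percolation

variable {V : Type*} [Fintype V] (G : SimpleGraph V)

lemma percWeight_nonneg {p : ℝ} (h0 : 0 ≤ p) (h1 : p ≤ 1) (S : Finset (Sym2 V)) :
    0 ≤ percWeight G p S :=
  mul_nonneg (pow_nonneg h0 _) (pow_nonneg (sub_nonneg.2 h1) _)

lemma sum_percWeight (p : ℝ) : ∑ S ∈ G.edgeFinset.powerset, percWeight G p S = 1 := by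
  simp only [percWeight, Finset.sum_pow_mul_eq_add_pow]
  simp

/-- Expectation of a product of single-edge functions. -/
lemma sum_percWeight_mul_prod (p : ℝ) (f g : Sym2 V → ℝ) :
    ∑ S ∈ G.edgeFinset.powerset,
      percWeight G p S * ((∏ e ∈ S, f e) * ∏ e ∈ G.edgeFinset \ S, g e) =
      ∏ e ∈ G.edgeFinset, (p * f e + (1 - p) * g e) := by
  rw [Finset.prod_add]
  refine Finset.sum_congr rfl fun S hS => ?_
  rw [Finset.mem_powerset] at hS
  rw [Finset.prod_mul_distrib, Finset.prod_mul_distrib, Finset.prod_const, Finset.prod_const,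
    Finset.card_sdiff_of_subset hS, percWeight]
  ring

lemma prod_ite_zero_one {α : Type*} (s : Finset α) (P : α → Prop) [DecidablePred P] :
    (∏ e ∈ s, if P e then (1 : ℝ) else 0) = if ∀ e ∈ s, P e then 1 else 0 := by
  rw [Finset.prod_ite_zero]
  simp

lemma prod_ite_mem_one {α : Type*} {s t : Finset α} (h : t ⊆ s) (x : ℝ) :
    (∏ e ∈ s, if e ∈ t then x else 1) = x ^ t.card := by
  rw [Finset.prod_ite_mem, Finset.inter_eq_right.2 h, Finset.prod_const]

/-- The probability that the open edges among `A` are exactly `T`. -/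
lemma percProb_inter_eq {A T : Finset (Sym2 V)} (hTA : T ⊆ A) (hA : A ⊆ G.edgeFinset) (q : ℝ) :
    percProb G q (fun S => S ∩ A = T) = q ^ T.card * (1 - q) ^ (A.card - T.card) := by
  have key := sum_percWeight_mul_prod G q (fun e => if e ∈ A → e ∈ T then 1 else 0)
    (fun e => if e ∉ T then 1 else 0)
  have hrhs : ∏ e ∈ G.edgeFinset, (q * (if e ∈ A → e ∈ T then 1 else 0) +
      (1 - q) * (if e ∉ T then 1 else 0)) = q ^ T.card * (1 - q) ^ (A.card - T.card) := by
    rw [← Finset.card_sdiff_of_subset hTA, ← prod_ite_mem_one (hTA.trans hA) q,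
      ← prod_ite_mem_one (Finset.sdiff_subset.trans hA) (1 - q), ← Finset.prod_mul_distrib]
    refine Finset.prod_congr rfl fun e _ => ?_
    by_cases h1 : e ∈ T
    · simp [h1]
    · by_cases h2 : e ∈ A <;> simp [h1, h2]
  rw [← hrhs, ← key, percProb]
  refine Finset.sum_congr rfl fun S hS => ?_
  rw [prod_ite_zero_one, prod_ite_zero_one]
  have hiff : S ∩ A = T ↔ (∀ e ∈ S, e ∈ A → e ∈ T) ∧ ∀ e ∈ G.edgeFinset \ S, e ∉ T := by
    constructor
    · rintro rfl
      refine ⟨fun e h1 h2 => Finset.mem_inter.2 ⟨h1, h2⟩, fun e h1 h2 => ?_⟩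
      exact (Finset.mem_sdiff.1 h1).2 (Finset.mem_inter.1 h2).1
    · rintro ⟨h1, h2⟩
      ext e
      refine ⟨fun h => h1 e (Finset.mem_inter.1 h).1 (Finset.mem_inter.1 h).2, fun h => ?_⟩
      refine Finset.mem_inter.2 ⟨?_, hTA h⟩
      by_contra he
      exact h2 e (Finset.mem_sdiff.2 ⟨hA (hTA h), he⟩) h
  by_cases h1 : ∀ e ∈ S, e ∈ A → e ∈ T
  · by_cases h2 : ∀ e ∈ G.edgeFinset \ S, e ∉ T
    · rw [if_pos (hiff.2 ⟨h1, h2⟩), if_pos h1, if_pos h2]; ring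
    · rw [if_neg (fun h => h2 (hiff.1 h).2), if_neg h2]; ring
  · rw [if_neg (fun h => h1 (hiff.1 h).1), if_neg h1]; ring

/-- The probability that the edges `T` are open in the union and the edges `B` are closed in the
first percolation. -/
lemma percProb2_subset_union_disjoint {T B : Finset (Sym2 V)} (hT : T ⊆ G.edgeFinset)
    (hB : B ⊆ G.edgeFinset) (hTB : Disjoint T B) (p₁ p₂ : ℝ) :
    percProb2 G p₁ p₂ (fun S₁ S₂ => (∀ e ∈ T, e ∈ S₁ ∨ e ∈ S₂) ∧ Disjoint S₁ B) =
      (1 - (1 - p₁) * (1 - p₂)) ^ T.card * (1 - p₁) ^ B.card := by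
  have inner (S₁ : Finset (Sym2 V)) (hS₁ : S₁ ⊆ G.edgeFinset) :
      ∑ S₂ ∈ G.edgeFinset.powerset, (if ∀ e ∈ T, e ∈ S₁ ∨ e ∈ S₂ then percWeight G p₂ S₂ else 0) =
        ∏ e ∈ G.edgeFinset \ S₁, if e ∈ T then p₂ else 1 := by
    have key := sum_percWeight_mul_prod G p₂ (fun _ => 1)
      (fun e => if e ∈ T → e ∈ S₁ then 1 else 0)
    have hrhs : ∏ e ∈ G.edgeFinset, (p₂ * 1 + (1 - p₂) * (if e ∈ T → e ∈ S₁ then 1 else 0)) =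
        ∏ e ∈ G.edgeFinset \ S₁, if e ∈ T then p₂ else 1 := by
      rw [← Finset.prod_sdiff hS₁, Finset.prod_eq_one (s := S₁), mul_one]
      · refine Finset.prod_congr rfl fun e he => ?_
        by_cases h : e ∈ T <;> simp [h, (Finset.mem_sdiff.1 he).2]
      · intro e he
        simp [he]
    rw [← hrhs, ← key]
    refine Finset.sum_congr rfl fun S₂ _ => ?_
    rw [prod_ite_zero_one]
    have hiff : (∀ e ∈ T, e ∈ S₁ ∨ e ∈ S₂) ↔ ∀ e ∈ G.edgeFinset \ S₂, e ∈ T → e ∈ S₁ := by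
      constructor
      · intro h e he heT
        exact (h e heT).resolve_right (Finset.mem_sdiff.1 he).2
      · intro h e heT
        by_cases he : e ∈ S₂
        · exact .inr he
        · exact .inl (h e (Finset.mem_sdiff.2 ⟨hT heT, he⟩) heT)
    by_cases h : ∀ e ∈ T, e ∈ S₁ ∨ e ∈ S₂
    · rw [if_pos h, if_pos (hiff.1 h)]; simp
    · rw [if_neg h, if_neg (fun h' => h (hiff.2 h'))]; simp
  have key := sum_percWeight_mul_prod G p₁ (fun e => if e ∉ B then 1 else 0)
    (fun e => if e ∈ T then p₂ else 1)
  have hrhs : ∏ e ∈ G.edgeFinset, (p₁ * (if e ∉ B then 1 else 0) +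
      (1 - p₁) * (if e ∈ T then p₂ else 1)) =
      (1 - (1 - p₁) * (1 - p₂)) ^ T.card * (1 - p₁) ^ B.card := by
    rw [← prod_ite_mem_one hT, ← prod_ite_mem_one hB, ← Finset.prod_mul_distrib]
    refine Finset.prod_congr rfl fun e _ => ?_
    by_cases h1 : e ∈ T
    · have h2 : e ∉ B := Finset.disjoint_left.1 hTB h1
      simp only [h1, h2, not_false_eq_true, if_true, if_false]
      ring
    · by_cases h2 : e ∈ B <;> simp [h1, h2]
  rw [← hrhs, ← key, percProb2]
  refine Finset.sum_congr rfl fun S₁ hS₁ => ?_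
  rw [Finset.mem_powerset] at hS₁
  rw [← inner S₁ hS₁, prod_ite_zero_one]
  have hiff : Disjoint S₁ B ↔ ∀ e ∈ S₁, e ∉ B := Finset.disjoint_left
  by_cases h : Disjoint S₁ B
  · rw [if_pos (hiff.1 h), one_mul, Finset.mul_sum]
    refine Finset.sum_congr rfl fun S₂ _ => ?_
    simp [h]
  · rw [if_neg (fun h' => h (hiff.2 h'))]
    simp [h]

/-- The union bound. -/
lemma one_sub_sum_le_percProb2 {ι : Type*} (J : Finset ι) {p₁ p₂ : ℝ} (h₁ : 0 ≤ p₁) (h₁' : p₁ ≤ 1)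
    (h₂ : 0 ≤ p₂) (h₂' : p₂ ≤ 1) (Q : Finset (Sym2 V) → Finset (Sym2 V) → Prop)
    (R : ι → Finset (Sym2 V) → Finset (Sym2 V) → Prop)
    (hQ : ∀ S₁ ⊆ G.edgeFinset, ∀ S₂ ⊆ G.edgeFinset, ¬ Q S₁ S₂ → ∃ i ∈ J, R i S₁ S₂) :
    1 - ∑ i ∈ J, percProb2 G p₁ p₂ (R i) ≤ percProb2 G p₁ p₂ Q := by
  have htot : ∑ S₁ ∈ G.edgeFinset.powerset, ∑ S₂ ∈ G.edgeFinset.powerset,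
      percWeight G p₁ S₁ * percWeight G p₂ S₂ = 1 := by
    rw [← Finset.sum_mul_sum, sum_percWeight, sum_percWeight, one_mul]
  rw [sub_le_iff_le_add, ← htot]
  unfold percProb2
  rw [Finset.sum_comm (s := J), ← Finset.sum_add_distrib]
  refine Finset.sum_le_sum fun S₁ hS₁ => ?_
  rw [Finset.sum_comm (s := J), ← Finset.sum_add_distrib]
  refine Finset.sum_le_sum fun S₂ hS₂ => ?_
  have hw := mul_nonneg (percWeight_nonneg G h₁ h₁' S₁) (percWeight_nonneg G h₂ h₂' S₂)
  have hnn : ∀ i ∈ J, 0 ≤ if R i S₁ S₂ then percWeight G p₁ S₁ * percWeight G p₂ S₂ else 0 :=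
    fun i _ => by split_ifs <;> simp [hw]
  by_cases h : Q S₁ S₂
  · rw [if_pos h]
    linarith [Finset.sum_nonneg hnn]
  · obtain ⟨i, hi, hR⟩ := hQ S₁ (Finset.mem_powerset.1 hS₁) S₂ (Finset.mem_powerset.1 hS₂) h
    have := Finset.single_le_sum hnn hi
    rw [if_pos hR] at this
    rw [if_neg h, zero_add]
    exact this

/-- The edges of `G` with an endpoint in `U`. -/
noncomputable def edgesTouching (U : Finset V) : Finset (Sym2 V) :=
  G.edgeFinset.filter fun e => ∃ a ∈ e, a ∈ U

/-- The edges of `G` with exactly one endpoint in `U`. -/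
noncomputable def edgeBoundary (U : Finset V) : Finset (Sym2 V) :=
  G.edgeFinset.filter fun e => (∃ a ∈ e, a ∈ U) ∧ ∃ b ∈ e, b ∉ U

lemma edgeBoundary_subset (U : Finset V) : edgeBoundary G U ⊆ G.edgeFinset :=
  Finset.filter_subset _ _

variable {G} in
lemma exists_mem_of_mem_edgeBoundary {U : Finset V} {e : Sym2 V} (he : e ∈ edgeBoundary G U) :
    (∃ a ∈ e, a ∈ U) ∧ ∃ b ∈ e, b ∉ U :=
  (Finset.mem_filter.1 he).2

lemma edgesWithin_coe (U : Finset V) :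
    edgesWithin G (↑U : Set V) = (G.edgeFinset.filter fun e => ∀ a ∈ e, a ∈ U).card := by
  rw [edgesWithin, Set.ncard_eq_toFinset_card']
  congr 1
  ext; simp

variable {G} in
lemma IsSubtree.card_le_edgesWithin {v : V} {U : Finset V} {T : Finset (Sym2 V)}
    (h : IsSubtree v U T) (hT : T ⊆ G.edgeFinset) : T.card ≤ edgesWithin G (↑U : Set V) := by
  rw [edgesWithin_coe]
  exact Finset.card_le_card fun e he => Finset.mem_filter.2 ⟨hT he, h.mem_of_mem_edge e he⟩

lemma card_edgesTouching (U : Finset V) :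
    (edgesTouching G U).card = edgesWithin G (↑U : Set V) + (edgeBoundary G U).card := by
  rw [edgesWithin_coe, edgeBoundary, edgesTouching, ← Finset.card_union_of_disjoint]
  · congr 1
    ext e
    induction e with | _ x y =>
    simp only [Finset.mem_filter, Finset.mem_union, Sym2.mem_iff]
    grind
  · rw [Finset.disjoint_left]
    intro e
    simp only [Finset.mem_filter]
    grind

lemma two_mul_edgesWithin_add_card_edgeBoundary {d : ℕ} (hG : isRegular G d) (U : Finset V) :
    2 * edgesWithin G (↑U : Set V) + (edgeBoundary G U).card = d * U.card := by
  have hdeg (u : V) : (G.edgeFinset.filter fun e => u ∈ e).card = d := by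
    rw [← G.incidenceFinset_eq_filter, G.card_incidenceFinset_eq_degree, ← hG u,
      Set.ncard_eq_toFinset_card', ← SimpleGraph.card_neighborFinset_eq_degree]
    rfl
  have hsum : ∑ u ∈ U, (G.edgeFinset.filter fun e => u ∈ e).card = d * U.card := by
    simp [hdeg, mul_comm]
  rw [← hsum, edgesWithin_coe, edgeBoundary]
  simp only [Finset.card_filter]
  rw [Finset.sum_comm, Finset.mul_sum, ← Finset.sum_add_distrib]
  refine Finset.sum_congr rfl fun e he => ?_
  induction e with | _ x y =>
  have hxy : x ≠ y := by
    rw [SimpleGraph.mem_edgeFinset, SimpleGraph.mem_edgeSet] at he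
    exact he.ne
  have : ∀ u, (if u ∈ s(x, y) then 1 else 0) =
      (if u = x then 1 else 0) + (if u = y then 1 else 0) := by
    intro u
    simp only [Sym2.mem_iff]
    by_cases h1 : u = x
    · subst h1; simp [hxy]
    · simp [h1]
  simp only [this, Finset.sum_add_distrib, Finset.sum_ite_eq']
  by_cases h1 : x ∈ U <;> by_cases h2 : y ∈ U <;> simp [h1, h2]

/-- Trees with a common root and no further open incident edges are the component of the root, so
the corresponding events are disjoint. -/
lemma sum_isSubtree_le_one (v : V) {q : ℝ} (h0 : 0 ≤ q) (h1 : q ≤ 1)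
    (J : Finset (Finset V × Finset (Sym2 V)))
    (hJ : ∀ x ∈ J, IsSubtree v x.1 x.2 ∧ x.2 ⊆ G.edgeFinset) :
    ∑ x ∈ J, q ^ x.2.card * (1 - q) ^ ((edgesTouching G x.1).card - x.2.card) ≤ 1 := by
  have hsub : ∀ x ∈ J, x.2 ⊆ edgesTouching G x.1 := by
    intro x hx e he
    refine Finset.mem_filter.2 ⟨(hJ x hx).2 he, ?_⟩
    induction e with | _ a b =>
    exact ⟨a, by simp, (hJ x hx).1.mem_of_mem_edge _ he a (by simp)⟩
  have hle : ∀ S ⊆ G.edgeFinset, ∀ x ∈ J, ∀ y ∈ J, S ∩ edgesTouching G x.1 = x.2 →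
      S ∩ edgesTouching G y.1 = y.2 → x.1 ⊆ y.1 := by
    intro S hS x hx y hy hSx hSy
    refine (hJ x hx).1.subset_of_closed (Y := (↑y.1 : Set V))
      (by simpa using (hJ y hy).1.root_mem) ?_
    intro a ha b hab
    have hS' : s(a, b) ∈ S := (Finset.mem_inter.1 (hSx ▸ hab)).1
    have : s(a, b) ∈ y.2 := by
      rw [← hSy]
      exact Finset.mem_inter.2 ⟨hS', Finset.mem_filter.2 ⟨hS hS', a, by simp, by simpa using ha⟩⟩
    simpa using (hJ y hy).1.mem_of_mem_edge _ this b (by simp)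
  have hprob : ∀ x ∈ J, q ^ x.2.card * (1 - q) ^ ((edgesTouching G x.1).card - x.2.card) =
      percProb G q (fun S => S ∩ edgesTouching G x.1 = x.2) := fun x hx =>
    (percProb_inter_eq G (hsub x hx) (Finset.filter_subset _ _) q).symm
  rw [Finset.sum_congr rfl hprob, ← sum_percWeight G q]
  unfold percProb
  rw [Finset.sum_comm]
  refine Finset.sum_le_sum fun S hS => ?_
  rw [Finset.mem_powerset] at hS
  have hfilter : (∑ x ∈ J, if S ∩ edgesTouching G x.1 = x.2 then percWeight G q S else 0) =
      ∑ x ∈ J.filter fun x => S ∩ edgesTouching G x.1 = x.2, percWeight G q S :=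
    (Finset.sum_filter _ _).symm
  refine (Finset.sum_congr rfl fun x _ => by congr).trans_le (hfilter.trans_le ?_)
  rw [Finset.sum_const, nsmul_eq_mul]
  refine mul_le_of_le_one_left (percWeight_nonneg G h0 h1 S) ?_
  rw [Nat.cast_le_one, Finset.card_le_one]
  intro x hx y hy
  rw [Finset.mem_filter] at hx hy
  have h : x.1 = y.1 := (hle S hS x hx.1 y hy.1 hx.2 hy.2).antisymm
    (hle S hS y hy.1 x hx.1 hy.2 hx.2)
  exact Prod.ext h (by rw [← hx.2, ← hy.2, h])

end Percolation

/-- The exponential rate governing the expected number of `G₁`-closed trees in `G₂`, as a function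
of the sprinkling parameter, is negative for some small positive parameter. -/
lemma exists_rate_neg {D lam : ℝ} (hD : 2 ≤ D) (h1 : 1 < lam) (h2 : lam < D) :
    ∃ δ, 0 < δ ∧ 1 < lam - δ ∧
      Real.log lam + (D - 1 - 2 * δ) * Real.log ((1 - lam / D) / (1 - δ / D)) -
        (D - 1) * Real.log (1 - 1 / D) < 0 := by
  have hD0 : 0 < D := by linarith
  have ha : 0 < 1 - lam / D := by rw [sub_pos, div_lt_one hD0]; exact h2
  have hb : 0 < 1 - 1 / D := by rw [sub_pos, div_lt_one hD0]; linarith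
  let f : ℝ → ℝ := fun δ => Real.log lam +
    (D - 1 - 2 * δ) * Real.log ((1 - lam / D) / (1 - δ / D)) - (D - 1) * Real.log (1 - 1 / D)
  have hf0 : f 0 < 0 := by
    have e1 : f 0 = Real.log lam + (D - 1) * Real.log ((1 - lam / D) / (1 - 1 / D)) := by
      simp only [f]
      rw [Real.log_div ha.ne' hb.ne']
      simp
      ring
    have e2 : Real.log ((1 - lam / D) / (1 - 1 / D)) ≤ (1 - lam / D) / (1 - 1 / D) - 1 :=
      Real.log_le_sub_one_of_pos (div_pos ha hb)
    have e3 : (D - 1) * ((1 - lam / D) / (1 - 1 / D) - 1) = 1 - lam := by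
      have : D - 1 ≠ 0 := by linarith
      field_simp
      ring
    have e4 : Real.log lam < lam - 1 := Real.log_lt_sub_one_of_pos (by linarith) h1.ne'
    have e5 := mul_le_mul_of_nonneg_left e2 (by linarith : (0 : ℝ) ≤ D - 1)
    linarith
  have hcont : ContinuousAt f 0 := by
    have : ContinuousAt (fun δ : ℝ => Real.log ((1 - lam / D) / (1 - δ / D))) 0 := by
      refine ContinuousAt.log (ContinuousAt.div (by fun_prop) (by fun_prop) (by simp)) ?_
      simpa using ha.ne'
    fun_prop
  have hev := (hcont.eventually_lt_const hf0).filter_mono (nhdsWithin_le_nhds (s := Set.Ioi 0))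
  have hev2 : ∀ᶠ δ in nhdsWithin (0 : ℝ) (Set.Ioi 0), δ ∈ Set.Ioo 0 (lam - 1) :=
    Ioo_mem_nhdsGT (by linarith)
  obtain ⟨δ, hδ, h0, hl⟩ := (hev.and hev2).exists
  exact ⟨δ, h0, by linarith, hδ⟩

/-- Comparison of the probability of a closed tree with its weight under critical percolation. -/
lemma tree_weight_le {D lam δ x p₁ : ℝ} {m t b i : ℕ} (hD : 2 ≤ D) (h1 : 1 < lam)
    (hp0 : 0 ≤ p₁) (hp1 : p₁ < 1) (ht : t + 1 = m)
    (hb : (D - 1 - 2 * δ) * m ≤ b) (hi : (i : ℝ) ≤ (D - 1) * m + 2)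
    (hx : m * (Real.log lam + (D - 1 - 2 * δ) * Real.log (1 - p₁) -
      (D - 1) * Real.log (1 - 1 / D)) ≤ x) :
    (lam / D) ^ t * (1 - p₁) ^ b ≤
      ((1 - 1 / D)⁻¹ ^ 2 * Real.exp x) * ((1 / D) ^ t * (1 - 1 / D) ^ i) := by
  have hD0 : 0 < D := by linarith
  have hq : 0 < 1 - 1 / D := by rw [sub_pos, div_lt_one hD0]; linarith
  have hq1 : Real.log (1 - 1 / D) ≤ 0 := Real.log_nonpos hq.le (by simp [hD0.le])
  have hp : 0 < 1 - p₁ := by linarith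
  have hpl : Real.log (1 - p₁) ≤ 0 := Real.log_nonpos hp.le (by linarith)
  have hl : 0 < Real.log lam := Real.log_pos h1
  have hpow {y : ℝ} (hy : 0 < y) (k : ℕ) : y ^ k = Real.exp (k * Real.log y) := by
    rw [Real.exp_nat_mul, Real.exp_log hy]
  have e0 : (lam / D) ^ t = lam ^ t * (1 / D) ^ t := by rw [← mul_pow]; ring
  have e1 : lam ^ t * (1 - p₁) ^ b ≤ (1 - 1 / D)⁻¹ ^ 2 * Real.exp x * (1 - 1 / D) ^ i := by
    rw [hpow (by linarith : 0 < lam), hpow hp, hpow (inv_pos.2 hq), hpow hq, ← Real.exp_add,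
      ← Real.exp_add, ← Real.exp_add, Real.exp_le_exp, Real.log_inv]
    have htm : (t : ℝ) ≤ m := by exact_mod_cast (by omega : t ≤ m)
    have a1 := mul_le_mul_of_nonneg_right htm hl.le
    have a2 := mul_le_mul_of_nonpos_right hb hpl
    have a3 := mul_le_mul_of_nonpos_right hi hq1
    push_cast
    linarith
  calc (lam / D) ^ t * (1 - p₁) ^ b = (1 / D) ^ t * (lam ^ t * (1 - p₁) ^ b) := by rw [e0]; ring
    _ ≤ (1 / D) ^ t * ((1 - 1 / D)⁻¹ ^ 2 * Real.exp x * (1 - 1 / D) ^ i) := by gcongr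
    _ = _ := by ring

/-- Sprinkling setup: `d ≥ 3`, `1 < λ < d-1`, `p = λ/(d-1)`, `δ > 0` with
`λ - δ > 1`, `p₂ = δ/(d-1)`, `(1-p₁)(1-p₂) = 1-p`; `G₁ = G_{p₁}`, `G₂ = G_{p₁} ∪ G_{p₂}`, and
`W = {v : |C_{G₁}(v)| ≥ 5λ log n/(λ-1)²}`. There exist constants `c, δ > 0` and `C > 0` such
that for every `ε > 0` there is `n₀`: for every `n ≥ n₀` and every `d`-regular graph `G` on
`n` vertices satisfying (P2), with probability at least `1-ε` there is no connected component
of `G₂` of order at least `log^C n` whose vertex set is disjoint from `W`. -/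
theorem statement_13 (d : ℕ) (hd : 3 ≤ d) (lam : ℝ) (hlam₁ : 1 < lam)
    (hlam₂ : lam < (d : ℝ) - 1) (p : ℝ) (hp : p = lam / ((d : ℝ) - 1)) :
    ∃ c > (0 : ℝ), ∃ δ : ℝ, (0 < δ ∧ 1 < lam - δ) ∧ ∃ C > (0 : ℝ),
    ∀ p₁ p₂ : ℝ, p₂ = δ / ((d : ℝ) - 1) → (1 - p₁) * (1 - p₂) = 1 - p →
    ∀ ε > (0 : ℝ), ∃ n₀ : ℕ, ∀ n : ℕ, n₀ ≤ n →
    ∀ G : SimpleGraph (Fin n), isRegular G d →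
    (∀ U : Set (Fin n), (U.ncard : ℝ) ≤ Real.log n ^ C →
      (edgesWithin G U : ℝ) ≤ (1 + c) * U.ncard) →
    1 - ε ≤ percProb2 G p₁ p₂ (fun S₁ S₂ =>
      ∀ v : Fin n,
        Real.log n ^ C
            ≤ (compCard (SimpleGraph.fromEdgeSet (↑(S₁ ∪ S₂) : Set (Sym2 (Fin n)))) v : ℝ) →
        ∃ u : Fin n,
          (SimpleGraph.fromEdgeSet (↑(S₁ ∪ S₂) : Set (Sym2 (Fin n)))).Reachable v u ∧
          5 * lam * Real.log n / (lam - 1) ^ 2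
            ≤ (compCard (SimpleGraph.fromEdgeSet (↑S₁ : Set (Sym2 (Fin n)))) u : ℝ)) := by
  have hd' : (3 : ℝ) ≤ d := by exact_mod_cast hd
  set D : ℝ := (d : ℝ) - 1 with hDdef
  have hD : 2 ≤ D := by linarith
  have hD0 : 0 < D := by linarith
  obtain ⟨δ, hδ0, hδ1, hrate⟩ := exists_rate_neg hD hlam₁ hlam₂
  refine ⟨δ, hδ0, δ, ⟨hδ0, hδ1⟩, 2, by norm_num, ?_⟩
  intro p₁ p₂ hp₂ hp₁ ε hε
  have hp2pos : 0 ≤ p₂ := by rw [hp₂]; positivity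
  have hp2p : p₂ ≤ p := by rw [hp₂, hp]; gcongr; linarith
  have hplt : p < 1 := by rw [hp, div_lt_one hD0]; exact hlam₂
  have hp2lt : p₂ < 1 := by linarith
  have hp1eq : 1 - p₁ = (1 - lam / D) / (1 - δ / D) := by
    rw [eq_div_iff (by rw [← hp₂]; linarith), ← hp, ← hp₂, hp₁]
  have hp1lt : p₁ < 1 := by
    have : 0 < 1 - p₁ := by
      rw [hp1eq, ← hp, ← hp₂]
      exact div_pos (by linarith) (by linarith)
    linarith
  have hp1pos : 0 ≤ p₁ := by
    have : 1 - p₁ ≤ 1 := by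
      rw [hp1eq, ← hp, ← hp₂, div_le_one (by linarith)]
      linarith
    linarith
  rw [← hp1eq] at hrate
  set r := Real.log lam + (D - 1 - 2 * δ) * Real.log (1 - p₁) - (D - 1) * Real.log (1 - 1 / D)
    with hr
  set A : ℝ := 2 / (-r) with hA
  have hA0 : 0 < A := div_pos two_pos (by linarith)
  set K : ℝ := 5 * lam / (lam - 1) ^ 2 with hK
  set κ : ℝ := (1 - 1 / D)⁻¹ ^ 2 with hκ
  obtain ⟨n₀, hn₀⟩ := Filter.eventually_atTop.1
    (((Real.tendsto_log_atTop.comp tendsto_natCast_atTop_atTop).eventually_ge_atTop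
      (max (A + K) 0)).and ((tendsto_natCast_atTop_atTop (R := ℝ)).eventually_ge_atTop
      (max (κ / ε) 1)))
  refine ⟨n₀, fun n hn G hG hP2 => ?_⟩
  obtain ⟨hlogn, hnbig⟩ := hn₀ n hn
  have hlog1 : A + K ≤ Real.log n := (le_max_left _ _).trans hlogn
  have hlog0 : 0 ≤ Real.log n := (le_max_right _ _).trans hlogn
  have hn1 : (1 : ℝ) ≤ n := (le_max_right _ _).trans hnbig
  have hnκ : κ / ε ≤ n := (le_max_left _ _).trans hnbig
  have hn0 : (0 : ℝ) < n := by linarith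
  have hupper : A * Real.log n + K * Real.log n ≤ Real.log n ^ (2 : ℝ) := by
    rw [Real.rpow_two, sq, ← add_mul]
    exact mul_le_mul_of_nonneg_right hlog1 hlog0
  have hK0 : 0 ≤ K := by positivity
  have hlower : A * Real.log n ≤ Real.log n ^ (2 : ℝ) := by
    linarith [mul_nonneg hK0 hlog0]
  let J (v : Fin n) : Finset (Finset (Fin n) × Finset (Sym2 (Fin n))) :=
    Finset.univ.filter fun x => IsSubtree v x.1 x.2 ∧ x.2 ⊆ G.edgeFinset ∧
      A * Real.log n ≤ x.1.card ∧ (x.1.card : ℝ) ≤ Real.log n ^ (2 : ℝ)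
  have hJ (v : Fin n) (x) (hx : x ∈ J v) : IsSubtree v x.1 x.2 ∧ x.2 ⊆ G.edgeFinset ∧
      A * Real.log n ≤ x.1.card ∧ (x.1.card : ℝ) ≤ Real.log n ^ (2 : ℝ) := by
    simpa [J] using hx
  have hunion := one_sub_sum_le_percProb2 G (Finset.univ.sigma J) hp1pos hp1lt.le hp2pos hp2lt.le
    (fun S₁ S₂ =>
      ∀ v : Fin n,
        Real.log n ^ (2 : ℝ)
            ≤ (compCard (SimpleGraph.fromEdgeSet (↑(S₁ ∪ S₂) : Set (Sym2 (Fin n)))) v : ℝ) →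
        ∃ u : Fin n,
          (SimpleGraph.fromEdgeSet (↑(S₁ ∪ S₂) : Set (Sym2 (Fin n)))).Reachable v u ∧
          5 * lam * Real.log n / (lam - 1) ^ 2
            ≤ (compCard (SimpleGraph.fromEdgeSet (↑S₁ : Set (Sym2 (Fin n)))) u : ℝ))
    (fun x S₁ S₂ => (∀ e ∈ x.2.2, e ∈ S₁ ∨ e ∈ S₂) ∧ Disjoint S₁ (edgeBoundary G x.2.1)) (by
      intro S₁ hS₁ S₂ hS₂ hnot
      push Not at hnot
      obtain ⟨v, hbig, hsmall⟩ := hnot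
      obtain ⟨U, T, hT, hTS, hcl, hLU, hUK⟩ := exists_isSubtree_closed
        (Finset.subset_union_left : S₁ ⊆ S₁ ∪ S₂) v (mul_nonneg hA0.le hlog0)
        (hlower.trans hbig) (K := K * Real.log n) (fun u hu => by
          have := hsmall u hu
          rwa [hK, div_mul_eq_mul_div])
      refine ⟨⟨v, U, T⟩, ?_, fun e he => Finset.mem_union.1 (hTS he), ?_⟩
      · simp only [Finset.mem_sigma, Finset.mem_univ, true_and, J, Finset.mem_filter]
        exact ⟨hT, hTS.trans (Finset.union_subset hS₁ hS₂), hLU, hUK.trans hupper⟩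
      · rw [Finset.disjoint_left]
        intro e he heB
        obtain ⟨⟨a, hae, haU⟩, b, hbe, hbU⟩ := exists_mem_of_mem_edgeBoundary heB
        have hne : a ≠ b := fun h => hbU (h ▸ haU)
        rw [(Sym2.mem_and_mem_iff hne).1 ⟨hae, hbe⟩] at he
        exact hbU (hcl a haU b he))
  have hterm (v : Fin n) (x) (hx : x ∈ J v) :
      percProb2 G p₁ p₂
        (fun S₁ S₂ => (∀ e ∈ x.2, e ∈ S₁ ∨ e ∈ S₂) ∧ Disjoint S₁ (edgeBoundary G x.1)) ≤
      (κ * Real.exp (-2 * Real.log n)) * ((1 / D) ^ x.2.card *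
        (1 - 1 / D) ^ ((edgesTouching G x.1).card - x.2.card)) := by
    obtain ⟨hT, hTE, hL, hM⟩ := hJ v x hx
    have hdisj : Disjoint x.2 (edgeBoundary G x.1) := by
      rw [Finset.disjoint_left]
      intro e he heB
      obtain ⟨-, b, hbe, hbU⟩ := exists_mem_of_mem_edgeBoundary heB
      exact hbU (hT.mem_of_mem_edge e he b hbe)
    rw [percProb2_subset_union_disjoint G hTE (edgeBoundary_subset G _) hdisj, hp₁,
      sub_sub_cancel, hp]
    have hcount := two_mul_edgesWithin_add_card_edgeBoundary G hG x.1
    have htouch := card_edgesTouching G x.1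
    have hcard := hT.card_add_one
    have hin := hT.card_le_edgesWithin hTE
    have hw := hP2 (↑x.1) (by simpa using hM)
    rw [Set.ncard_coe_finset] at hw
    have hcount' : 2 * (edgesWithin G (↑x.1 : Set (Fin n)) : ℝ) + (edgeBoundary G x.1).card =
        (D + 1) * x.1.card := by
      rw [hDdef, sub_add_cancel]; exact_mod_cast hcount
    refine tree_weight_le (m := x.1.card) hD hlam₁ hp1pos hp1lt hcard ?_ ?_ ?_ (δ := δ)
    · linarith
    · rw [Nat.cast_sub (by omega), htouch]
      have hin' : (x.2.card : ℝ) ≤ edgesWithin G (↑x.1 : Set (Fin n)) := by exact_mod_cast hin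
      have hcard' : (x.2.card : ℝ) + 1 = x.1.card := by exact_mod_cast hcard
      push_cast
      linarith
    · rw [← hr]
      have h1 := mul_le_mul_of_nonpos_right hL hrate.le
      have h2 : A * Real.log n * r = -2 * Real.log n := by
        have hr0 : r ≠ 0 := hrate.ne
        rw [hA]
        field_simp
      linarith
  have hq0 : 0 ≤ 1 / D := by positivity
  have hq1 : 1 / D ≤ 1 := by rw [div_le_one hD0]; linarith
  have hκ0 : 0 ≤ κ := by positivity
  have hsum : ∑ x ∈ Finset.univ.sigma J, percProb2 G p₁ p₂
      (fun S₁ S₂ => (∀ e ∈ x.2.2, e ∈ S₁ ∨ e ∈ S₂) ∧ Disjoint S₁ (edgeBoundary G x.2.1)) ≤ ε := by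
    rw [Finset.sum_sigma]
    have hv : ∀ v ∈ (Finset.univ : Finset (Fin n)), ∑ x ∈ J v, percProb2 G p₁ p₂
        (fun S₁ S₂ => (∀ e ∈ x.2, e ∈ S₁ ∨ e ∈ S₂) ∧ Disjoint S₁ (edgeBoundary G x.1)) ≤
        κ * Real.exp (-2 * Real.log n) := fun v _ => by
      refine (Finset.sum_le_sum (hterm v)).trans ?_
      rw [← Finset.mul_sum]
      exact mul_le_of_le_one_right (by positivity) (sum_isSubtree_le_one G v hq0 hq1 (J v)
        fun x hx => ⟨(hJ v x hx).1, (hJ v x hx).2.1⟩)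
    refine (Finset.sum_le_sum hv).trans ?_
    have hexp : Real.exp (-2 * Real.log n) = ((n : ℝ) ^ 2)⁻¹ := by
      rw [neg_mul, Real.exp_neg, ← Nat.cast_two, Real.exp_nat_mul, Real.exp_log hn0]
    rw [hexp, Finset.sum_const, Finset.card_univ, Fintype.card_fin, nsmul_eq_mul]
    rw [div_le_iff₀ hε] at hnκ
    have : (n : ℝ) * (κ * ((n : ℝ) ^ 2)⁻¹) = κ / n := by field_simp
    rw [this, div_le_iff₀ hn0]
    linarith
  linarith
end
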